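/- arXiv:1511.00097 — 5 statements merged into one kernel-verified Lean document; each statement's English description precedes it below -/
import Mathlib

section
/- Let p ≥ 1 and λ > γ_p, let h ∈ C²(ℝ) satisfy −h''(t) + |t|^p h(t) = γ_p h(t) for all t, ∫_ℝ h² = 1, and assume all weighted norms ∫_ℝ (1+|t|)^{2N}(h(t)² + h'(t)² + h''(t)²) dt are finite for every N. Let χ ∈ C^∞(ℝ) have support contained in [1,2] with ∫_1^2 χ(z)² dz = 1, set β = ((p+2)/(2p+2))·√(λ−γ_p), and for k ≥ 1 define ψ_k(x,y) = k^{−1/(p+2)} h(x y^{p/(p+2)}) e^{iβ y^{(2p+2)/(p+2)}} χ(y/k) on ℝ × (0,∞), extended by 0. Then ∫_{ℝ²}|ψ_k|² dx dy ≥ 2^{−p/(p+2)} for every k ≥ 1, and ∫_{ℝ²} |−Δψ_k + (|xy|^p − λ(x²+y²)^{p/(p+2)})ψ_k|² dx dy → 0 as k → ∞. -/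
open MeasureTheory Filter

/-- `γ_p`: the lowest spectral point (ground-state energy) of the one-dimensional
Schrödinger operator `H_p : u ↦ -u'' + |t|^p u` on `L²(ℝ)`, defined variationally:
`γ_p = inf {∫ (|u'|² + |t|^p |u|²) : u ∈ C_c^∞(ℝ), ∫ |u|² = 1}`. -/
noncomputable def gammaP (p : ℝ) : ℝ :=
  sInf { E : ℝ | ∃ u : ℝ → ℝ, ContDiff ℝ (⊤ : ℕ∞) u ∧ HasCompactSupport u ∧
    (∫ t : ℝ, (u t) ^ 2) = 1 ∧
    E = ∫ t : ℝ, ((deriv u t) ^ 2 + |t| ^ p * (u t) ^ 2) }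

/-- The potential `|xy|^p − λ (x²+y²)^{p/(p+2)}` on `ℝ²`. -/
noncomputable def schrodV (p lam : ℝ) (q : ℝ × ℝ) : ℝ :=
  |q.1 * q.2| ^ p - lam * (q.1 ^ 2 + q.2 ^ 2) ^ (p / (p + 2))

/-- The differential expression `L_p(λ)ψ = −Δψ + (|xy|^p − λ(x²+y²)^{p/(p+2)})ψ`. -/
noncomputable def schrodOp (p lam : ℝ) (ψ : ℝ × ℝ → ℂ) (q : ℝ × ℝ) : ℂ :=
  -(deriv (deriv fun x => ψ (x, q.2)) q.1 + deriv (deriv fun y => ψ (q.1, y)) q.2)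
    + (schrodV p lam q : ℂ) * ψ q

/-- The Weyl sequence
`ψ_k(x,y) = k^{-1/(p+2)} h(x y^{p/(p+2)}) e^{iβ y^{(2p+2)/(p+2)}} χ(y/k)` on
`ℝ × (0,∞)`, extended by `0`, with `β = ((p+2)/(2p+2))√(λ−γ_p)`. -/
noncomputable def weylSeq (p lam : ℝ) (h χ : ℝ → ℝ) (k : ℕ) (q : ℝ × ℝ) : ℂ :=
  if 0 < q.2 then
    (((k : ℝ) ^ (-(1 : ℝ) / (p + 2)) * h (q.1 * q.2 ^ (p / (p + 2))) *
        χ (q.2 / (k : ℝ)) : ℝ) : ℂ) *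
      Complex.exp (Complex.I *
        ((((p + 2) / (2 * p + 2) * Real.sqrt (lam - gammaP p)) *
          q.2 ^ ((2 * p + 2) / (p + 2)) : ℝ) : ℂ))
  else 0

theorem deriv_deriv_ofReal_mul_exp {g g₁ g₂ φ φ₁ φ₂ : ℝ → ℝ} {F : ℝ → ℂ} {c : ℝ}
    (hg : ∀ y, 0 < y → HasDerivAt g (g₁ y) y) (hg₁ : ∀ y, 0 < y → HasDerivAt g₁ (g₂ y) y)
    (hφ : ∀ y, 0 < y → HasDerivAt φ (φ₁ y) y) (hφ₁ : ∀ y, 0 < y → HasDerivAt φ₁ (φ₂ y) y)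
    (hF : ∀ y, 0 < y → F y = ((c * g y : ℝ) : ℂ) * Complex.exp (Complex.I * (φ y : ℂ)))
    {y : ℝ} (hy : 0 < y) :
    deriv (deriv F) y = (c : ℂ) * ((g₂ y - φ₁ y ^ 2 * g y : ℝ) +
      Complex.I * ((2 * φ₁ y * g₁ y + φ₂ y * g y : ℝ) : ℂ)) *
        Complex.exp (Complex.I * (φ y : ℂ)) := by
  have hexp : ∀ y, 0 < y → HasDerivAt (fun y => Complex.exp (Complex.I * (φ y : ℂ)))
      (Complex.exp (Complex.I * (φ y : ℂ)) * (Complex.I * (φ₁ y : ℂ))) y := fun y hy =>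
    ((hφ y hy).ofReal_comp.const_mul Complex.I).cexp
  have hd : ∀ y, 0 < y → deriv F y = (c : ℂ) * ((g₁ y : ℂ) + Complex.I * ((φ₁ y : ℂ) * g y)) *
      Complex.exp (Complex.I * (φ y : ℂ)) := by
    intro y hy
    have hev : F =ᶠ[nhds y] fun y =>
        ((c * g y : ℝ) : ℂ) * Complex.exp (Complex.I * (φ y : ℂ)) := by
      filter_upwards [lt_mem_nhds hy] with z hz using hF z hz
    rw [hev.deriv_eq]
    refine ((((hg y hy).const_mul c).ofReal_comp.mul (hexp y hy)).congr_deriv ?_).deriv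
    push_cast
    ring
  have hev : deriv F =ᶠ[nhds y] fun y => (c : ℂ) * ((g₁ y : ℂ) +
      Complex.I * ((φ₁ y : ℂ) * g y)) * Complex.exp (Complex.I * (φ y : ℂ)) := by
    filter_upwards [lt_mem_nhds hy] with z hz using hd z hz
  rw [hev.deriv_eq]
  refine ((((((hg₁ y hy).ofReal_comp.add
    (((hφ₁ y hy).ofReal_comp.mul (hg y hy).ofReal_comp).const_mul Complex.I)).const_mul
      (c : ℂ))).mul (hexp y hy)).congr_deriv ?_).deriv
  simp only [Pi.add_apply, Pi.mul_apply]
  push_cast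
  linear_combination (c : ℂ) * (φ₁ y : ℂ) ^ 2 * g y * Complex.exp (Complex.I * (φ y : ℂ)) *
    Complex.I_sq

theorem integral_comp_mul_rpow_mul {F W : ℝ → ℝ} (s : ℝ) (hFc : Continuous F)
    (hF : Integrable F) (hWm : Measurable W) (hW0 : ∀ y, y ≤ 0 → W y = 0)
    (hW : Integrable fun y => y ^ (-s) * W y) :
    Integrable (fun q : ℝ × ℝ => F (q.1 * q.2 ^ s) * W q.2) ∧
      ∫ q : ℝ × ℝ, F (q.1 * q.2 ^ s) * W q.2 = (∫ t, F t) * ∫ y, y ^ (-s) * W y := by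
  have key : ∀ (f : ℝ → ℝ) (y w : ℝ), (y ≤ 0 → w = 0) →
      ∫ x, f (x * y ^ s) * w = (∫ t, f t) * (y ^ (-s) * w) := by
    intro f y w h0
    rcases le_or_gt y 0 with hy | hy
    · simp [h0 hy]
    · rw [integral_mul_const, Measure.integral_comp_mul_right, Real.rpow_neg hy.le,
        abs_of_nonneg (by positivity), smul_eq_mul]
      ring
  have hint : Integrable (fun q : ℝ × ℝ => F (q.1 * q.2 ^ s) * W q.2)
      ((volume : Measure ℝ).prod volume) := by
    have hm : Measurable (fun q : ℝ × ℝ => F (q.1 * q.2 ^ s) * W q.2) :=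
      (hFc.measurable.comp (by fun_prop)).mul (hWm.comp measurable_snd)
    rw [integrable_prod_iff' hm.aestronglyMeasurable]
    refine ⟨Eventually.of_forall fun y => ?_, ?_⟩
    · rcases le_or_gt y 0 with hy | hy
      · simp [hW0 y hy]
      · exact (hF.comp_mul_right' (Real.rpow_pos_of_pos hy s).ne').mul_const (W y)
    · have : (fun y => ∫ x, ‖F (x * y ^ s) * W y‖) =
          fun y => (∫ t, |F t|) * ‖y ^ (-s) * W y‖ := by
        funext y
        simp only [Real.norm_eq_abs, abs_mul]
        rw [key (fun t => |F t|) y |W y| (fun hy => by simp [hW0 y hy])]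
        rcases le_or_gt y 0 with hy | hy
        · simp [hW0 y hy]
        · rw [abs_of_nonneg (Real.rpow_nonneg hy.le (-s))]
      rw [this]
      exact hW.norm.const_mul _
  refine ⟨hint, ?_⟩
  rw [Measure.volume_eq_prod, integral_prod_symm _ hint, ← integral_const_mul]
  exact integral_congr_ae (Eventually.of_forall fun y => key F y (W y) (hW0 y))

theorem abs_rpow_sq_add_sq_sub_le {s : ℝ} (hs0 : 0 ≤ s) (hs1 : s ≤ 1) (x : ℝ) {y : ℝ}
    (hy : 0 < y) :
    |(x ^ 2 + y ^ 2) ^ s - y ^ (2 * s)| ≤ (x * y ^ s) ^ 2 / y ^ 2 := by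
  have h1 : x ^ 2 + y ^ 2 = y ^ 2 * (1 + x ^ 2 / y ^ 2) := by field_simp; ring
  have h2 : (y ^ 2) ^ s = (y ^ s) ^ 2 := by
    rw [← Real.rpow_natCast, ← Real.rpow_mul hy.le, mul_comm, Real.rpow_mul hy.le,
      Real.rpow_natCast]
  have h3 : y ^ (2 * s) = (y ^ s) ^ 2 := by
    rw [mul_comm, Real.rpow_mul hy.le]; norm_num
  have hu : 0 ≤ x ^ 2 / y ^ 2 := by positivity
  have h4 : (1 + x ^ 2 / y ^ 2) ^ s ≤ 1 + s * (x ^ 2 / y ^ 2) :=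
    rpow_one_add_le_one_add_mul_self (by linarith) hs0 hs1
  have h5 : 1 ≤ (1 + x ^ 2 / y ^ 2) ^ s := Real.one_le_rpow (by linarith) hs0
  rw [h1, Real.mul_rpow (by positivity) (by positivity), h2, h3, abs_of_nonneg
    (by nlinarith [sq_nonneg (y ^ s)])]
  have h6 : s * (x ^ 2 / y ^ 2) ≤ x ^ 2 / y ^ 2 := mul_le_of_le_one_left hu hs1
  calc (y ^ s) ^ 2 * (1 + x ^ 2 / y ^ 2) ^ s - (y ^ s) ^ 2
      ≤ (y ^ s) ^ 2 * (1 + x ^ 2 / y ^ 2) - (y ^ s) ^ 2 := by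
        gcongr; linarith
    _ = (x * y ^ s) ^ 2 / y ^ 2 := by field_simp; ring

theorem exists_forall_abs_le_of_support_subset_Icc {χ : ℝ → ℝ} (hχ : ContDiff ℝ (⊤ : ℕ∞) χ)
    {a b : ℝ} (hχsupp : Function.support χ ⊆ Set.Icc a b) :
    ∃ B, 0 ≤ B ∧ ∀ z, |χ z| ≤ B ∧ |deriv χ z| ≤ B ∧ |deriv (deriv χ) z| ≤ B := by
  have hc : HasCompactSupport χ :=
    HasCompactSupport.of_support_subset_isCompact isCompact_Icc hχsupp
  have h1 : ContDiff ℝ (⊤ : ℕ∞) (deriv χ) := (contDiff_infty_iff_deriv.1 hχ).2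
  have h2 : ContDiff ℝ (⊤ : ℕ∞) (deriv (deriv χ)) := (contDiff_infty_iff_deriv.1 h1).2
  obtain ⟨B0, hB0⟩ := hc.exists_bound_of_continuous hχ.continuous
  obtain ⟨B1, hB1⟩ := hc.deriv.exists_bound_of_continuous h1.continuous
  obtain ⟨B2, hB2⟩ := hc.deriv.deriv.exists_bound_of_continuous h2.continuous
  simp only [Real.norm_eq_abs] at hB0 hB1 hB2
  refine ⟨max B0 (max B1 B2), ?_, fun z => ⟨?_, ?_, ?_⟩⟩
  · exact (abs_nonneg _).trans ((hB0 0).trans (le_max_left _ _))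
  · exact (hB0 z).trans (le_max_left _ _)
  · exact (hB1 z).trans ((le_max_left _ _).trans (le_max_right _ _))
  · exact (hB2 z).trans ((le_max_right _ _).trans (le_max_right _ _))

theorem hasDerivAt_mul_rpow (x s : ℝ) {y : ℝ} (hy : 0 < y) :
    HasDerivAt (fun y => x * y ^ s) (x * (s * y ^ (s - 1))) y :=
  (Real.hasDerivAt_rpow_const (Or.inl hy.ne')).const_mul x

theorem hasDerivAt_comp_mul_rpow {f f' : ℝ → ℝ} (hf : ∀ t, HasDerivAt f (f' t) t) (x s : ℝ)
    {y : ℝ} (hy : 0 < y) :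
    HasDerivAt (fun y => f (x * y ^ s)) (f' (x * y ^ s) * (x * (s * y ^ (s - 1)))) y :=
  (hf (x * y ^ s)).comp y (hasDerivAt_mul_rpow x s hy)

theorem hasDerivAt_comp_div {f f' : ℝ → ℝ} (hf : ∀ t, HasDerivAt f (f' t) t) (k y : ℝ) :
    HasDerivAt (fun y => f (y / k)) (f' (y / k) / k) y :=
  ((hf (y / k)).comp y ((hasDerivAt_id y).div_const k)).congr_deriv (by ring)

theorem deriv_deriv_comp_mul_mul_const {h : ℝ → ℝ} (hh : ContDiff ℝ 2 h) {F : ℝ → ℂ} {a b : ℝ}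
    {w : ℂ} (hF : ∀ x, F x = (h (x * a) * b : ℝ) * w) (x : ℝ) :
    deriv (deriv F) x = (deriv (deriv h) (x * a) * a ^ 2 * b : ℝ) * w := by
  have h1 : ∀ t, HasDerivAt h (deriv h t) t := fun t =>
    (hh.differentiable (by norm_num) t).hasDerivAt
  have h2 : ∀ t, HasDerivAt (deriv h) (deriv (deriv h) t) t := fun t =>
    ((hh.differentiable_deriv_two) t).hasDerivAt
  have hs : ∀ x, HasDerivAt (fun x => x * a) a x := fun x => by
    simpa using (hasDerivAt_id x).mul_const a
  have hd : deriv F = fun x => ((deriv h (x * a) * a * b : ℝ) : ℂ) * w := by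
    funext x
    rw [funext hF]
    exact ((((h1 (x * a)).comp x (hs x)).mul_const b).ofReal_comp.mul_const w).deriv
  rw [hd]
  refine ((((((h2 (x * a)).comp x (hs x)).mul_const a).mul_const b).ofReal_comp.mul_const
    w).congr_deriv ?_).deriv
  push_cast
  ring

theorem abs_mul_rpow_eq {p : ℝ} (hp : 1 ≤ p) (x : ℝ) {y : ℝ} (hy : 0 < y) :
    |x * y| ^ p = |x * y ^ (p / (p + 2))| ^ p * (y ^ (p / (p + 2))) ^ 2 := by
  rw [abs_mul, abs_mul, Real.mul_rpow (abs_nonneg _) (abs_nonneg _),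
    Real.mul_rpow (abs_nonneg _) (abs_nonneg _), abs_of_pos hy,
    abs_of_pos (Real.rpow_pos_of_pos hy _), mul_assoc, ← Real.rpow_natCast,
    ← Real.rpow_mul hy.le, ← Real.rpow_mul hy.le, ← Real.rpow_add hy]
  congr 2
  have : p + 2 ≠ 0 := by linarith
  field_simp
  push_cast
  ring

theorem sq_rpow_neg_one_div_add_two {p : ℝ} (hp : 1 ≤ p) {a : ℝ} (ha : 0 < a) :
    (a ^ (-(1 : ℝ) / (p + 2))) ^ 2 = a ^ (p / (p + 2) - 1) := by
  rw [← Real.rpow_natCast, ← Real.rpow_mul ha.le]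
  congr 1
  have : p + 2 ≠ 0 := by linarith
  field_simp
  push_cast
  ring

theorem norm_weylSeq {p lam : ℝ} {h χ : ℝ → ℝ} {k : ℕ} {q : ℝ × ℝ} (hq : 0 < q.2) :
    ‖weylSeq p lam h χ k q‖ =
      |(k : ℝ) ^ (-(1 : ℝ) / (p + 2)) * h (q.1 * q.2 ^ (p / (p + 2))) * χ (q.2 / (k : ℝ))| := by
  rw [weylSeq, if_pos hq, norm_mul, mul_comm Complex.I, Complex.norm_exp_ofReal_mul_I, mul_one,
    Complex.norm_real, Real.norm_eq_abs]

theorem schrodOp_weylSeq {p lam : ℝ} (hp : 1 ≤ p) (hlam : gammaP p < lam)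
    {h : ℝ → ℝ} (hh : ContDiff ℝ 2 h)
    (hode : ∀ t : ℝ, -(deriv (deriv h) t) + |t| ^ p * h t = gammaP p * h t)
    {χ : ℝ → ℝ} (hχ : ContDiff ℝ (⊤ : ℕ∞) χ) (k : ℕ) {s : ℝ} (hs : s = p / (p + 2))
    (x : ℝ) {y : ℝ} (hy : 0 < y) {m g g₁ g₂ : ℝ} (hm : m = Real.sqrt (lam - gammaP p))
    (hg : g = h (x * y ^ s) * χ (y / k))
    (hg₁ : g₁ = deriv h (x * y ^ s) * (x * (s * y ^ (s - 1))) * χ (y / k) +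
      h (x * y ^ s) * (deriv χ (y / k) / k))
    (hg₂ : g₂ = (deriv (deriv h) (x * y ^ s) * (x * (s * y ^ (s - 1))) * (x * (s * y ^ (s - 1))) +
        deriv h (x * y ^ s) * (x * (s * ((s - 1) * y ^ (s - 1 - 1))))) * χ (y / k) +
      deriv h (x * y ^ s) * (x * (s * y ^ (s - 1))) * (deriv χ (y / k) / k) +
      (deriv h (x * y ^ s) * (x * (s * y ^ (s - 1))) * (deriv χ (y / k) / k) +
        h (x * y ^ s) * (deriv (deriv χ) (y / k) / k / k))) :
    ‖schrodOp p lam (weylSeq p lam h χ k) (x, y)‖ ≤ (k : ℝ) ^ (-(1 : ℝ) / (p + 2)) *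
      (|g₂ + lam * ((x ^ 2 + y ^ 2) ^ s - y ^ (2 * s)) * g| +
        |2 * (m * y ^ s) * g₁ + m * (s * y ^ (s - 1)) * g|) := by
  have h1 : ∀ t, HasDerivAt h (deriv h t) t := fun t =>
    (hh.differentiable (by norm_num) t).hasDerivAt
  have h2 : ∀ t, HasDerivAt (deriv h) (deriv (deriv h) t) t := fun t =>
    ((hh.differentiable_deriv_two) t).hasDerivAt
  have hχ' : ContDiff ℝ (⊤ : ℕ∞) (deriv χ) := (contDiff_infty_iff_deriv.1 hχ).2
  have c1 : ∀ t, HasDerivAt χ (deriv χ t) t := fun t =>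
    (hχ.differentiable (by simp) t).hasDerivAt
  have c2 : ∀ t, HasDerivAt (deriv χ) (deriv (deriv χ) t) t := fun t =>
    (hχ'.differentiable (by simp) t).hasDerivAt
  have hp2 : p + 2 ≠ 0 := by linarith
  have hp1 : 2 * p + 2 ≠ 0 := by linarith
  have hs1 : (2 * p + 2) / (p + 2) = 1 + s := by rw [hs]; field_simp; ring
  have hb : (p + 2) / (2 * p + 2) * m * (1 + s) = m := by
    rw [← hs1]; field_simp
  set φ : ℝ → ℝ := fun y => (p + 2) / (2 * p + 2) * m * y ^ ((2 * p + 2) / (p + 2)) with hφdef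
  set c : ℝ := (k : ℝ) ^ (-(1 : ℝ) / (p + 2)) with hc
  have hφ : ∀ y, 0 < y → HasDerivAt φ (m * y ^ s) y := fun y hy =>
    (hasDerivAt_mul_rpow _ _ hy).congr_deriv (by
      rw [hs1, ← mul_assoc, hb]; norm_num)
  have hyy : deriv (deriv fun y => weylSeq p lam h χ k (x, y)) y =
      (c : ℂ) * (((g₂ - (m * y ^ s) ^ 2 * g : ℝ) : ℂ) + Complex.I *
        ((2 * (m * y ^ s) * g₁ + m * (s * y ^ (s - 1)) * g : ℝ) : ℂ)) *
          Complex.exp (Complex.I * (φ y : ℂ)) := by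
    rw [hg, hg₁, hg₂]
    exact deriv_deriv_ofReal_mul_exp
      (fun y hy => (hasDerivAt_comp_mul_rpow h1 x s hy).mul (hasDerivAt_comp_div c1 k y))
      (fun y hy => (((hasDerivAt_comp_mul_rpow h2 x s hy).mul
        (((Real.hasDerivAt_rpow_const (Or.inl hy.ne')).const_mul s).const_mul x)).mul
          (hasDerivAt_comp_div c1 k y)).add
        ((hasDerivAt_comp_mul_rpow h1 x s hy).mul ((hasDerivAt_comp_div c2 k y).div_const (k : ℝ))))
      hφ (fun y hy => hasDerivAt_mul_rpow m s hy)
      (fun y hy => by simp [weylSeq, hy, hφdef, hm, hc, hs, mul_assoc]) hy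
  have hxx := deriv_deriv_comp_mul_mul_const hh (F := fun x => weylSeq p lam h χ k (x, y))
    (a := y ^ s) (b := c * χ (y / k)) (w := Complex.exp (Complex.I * (φ y : ℂ)))
    (fun x => by simp [weylSeq, hy, hφdef, hm, hc, hs]; ring) x
  have hψ : weylSeq p lam h χ k (x, y) =
      ((c * g : ℝ) : ℂ) * Complex.exp (Complex.I * (φ y : ℂ)) := by
    simp [weylSeq, hy, hφdef, hm, hc, hs, hg, mul_assoc]
  have hm2 : m ^ 2 = lam - gammaP p := by rw [hm, Real.sq_sqrt (by linarith)]
  have hy2 : y ^ (2 * s) = (y ^ s) ^ 2 := by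
    rw [mul_comm, Real.rpow_mul hy.le]; norm_num
  have hc0 : 0 ≤ c := by positivity
  have hode' := hode (x * y ^ s)
  have key : schrodOp p lam (weylSeq p lam h χ k) (x, y) =
      -((c : ℂ) * (((g₂ + lam * ((x ^ 2 + y ^ 2) ^ s - y ^ (2 * s)) * g : ℝ) : ℂ) +
        Complex.I * ((2 * (m * y ^ s) * g₁ + m * (s * y ^ (s - 1)) * g : ℝ) : ℂ)) *
          Complex.exp (Complex.I * (φ y : ℂ))) := by
    have hdd : deriv (deriv h) (x * y ^ s) = |x * y ^ s| ^ p * h (x * y ^ s) -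
      gammaP p * h (x * y ^ s) := by linarith
    have hV : schrodV p lam (x, y) = |x * y ^ s| ^ p * (y ^ s) ^ 2 -
        lam * (x ^ 2 + y ^ 2) ^ s := by
      rw [schrodV, abs_mul_rpow_eq hp x hy, hs]
    simp only [schrodOp]
    rw [hxx, hyy, hψ, hV, hdd, hy2, hg]
    have hm2' : (m : ℂ) ^ 2 = lam - gammaP p := by exact_mod_cast hm2
    push_cast
    linear_combination (c : ℂ) * ((y ^ s : ℝ) : ℂ) ^ 2 * h (x * y ^ s) * χ (y / k) *
      Complex.exp (Complex.I * (φ y : ℂ)) * hm2'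
  rw [key, norm_neg, norm_mul, norm_mul, mul_comm Complex.I (φ y : ℂ),
    Complex.norm_exp_ofReal_mul_I, mul_one, Complex.norm_real, Real.norm_eq_abs,
    abs_of_nonneg hc0]
  gcongr
  refine (norm_add_le _ _).trans ?_
  rw [norm_mul, Complex.norm_I, one_mul, Complex.norm_real, Complex.norm_real,
    Real.norm_eq_abs, Real.norm_eq_abs]

theorem abs_add_abs_le_of_amplitude_bounds {a₀ a₁ a₂ x₀ x₁ x₂ B S T κ r m lam D u v w e : ℝ}
    (h₀ : |a₀| ≤ S) (h₁ : |a₁| ≤ S) (h₂ : |a₂| ≤ S)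
    (hx₀ : |x₀| ≤ B) (hx₁ : |x₁| ≤ B) (hx₂ : |x₂| ≤ B) (hT : 1 ≤ T) (hκ : 0 ≤ κ)
    (hκr : κ ^ 2 ≤ r) (hu : |u| ≤ T * κ) (hv : |v| ≤ T * κ ^ 2) (hD : |D| ≤ T ^ 2 * κ ^ 2)
    (hm : 0 ≤ m) (hw : |w| * κ ≤ 2 * r) (he : |e| ≤ r) :
    |((a₂ * u * u + a₁ * v) * x₀ + a₁ * u * (x₁ * κ) + (a₁ * u * (x₁ * κ) + a₀ * (x₂ * κ * κ))) +
        lam * D * (a₀ * x₀)| +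
      |2 * (m * w) * (a₁ * u * x₀ + a₀ * (x₁ * κ)) + m * e * (a₀ * x₀)| ≤
    B * (5 + 9 * m + |lam|) * (r * (T ^ 2 * S)) := by
  have hS : 0 ≤ S := (abs_nonneg _).trans h₀
  have hB : 0 ≤ B := (abs_nonneg _).trans hx₀
  have hT0 : 0 ≤ T := by linarith
  have hTT : T ≤ T ^ 2 := by nlinarith
  have h1T : 1 ≤ T ^ 2 := by nlinarith
  have hr : 0 ≤ r := (sq_nonneg κ).trans hκr
  set P := B * (r * (T ^ 2 * S)) with hP
  have e1 : |a₂ * u * u * x₀| ≤ P := by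
    simp only [abs_mul]
    calc |a₂| * |u| * |u| * |x₀| ≤ S * (T * κ) * (T * κ) * B := by gcongr
      _ = B * (κ ^ 2 * (T ^ 2 * S)) := by ring
      _ ≤ P := by rw [hP]; gcongr
  have e2 : |a₁ * v * x₀| ≤ P := by
    simp only [abs_mul]
    calc |a₁| * |v| * |x₀| ≤ S * (T * κ ^ 2) * B := by gcongr
      _ = B * (κ ^ 2 * (T * S)) := by ring
      _ ≤ P := by rw [hP]; gcongr
  have e3 : |a₁ * u * (x₁ * κ)| ≤ P := by
    simp only [abs_mul, abs_of_nonneg hκ]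
    calc |a₁| * |u| * (|x₁| * κ) ≤ S * (T * κ) * (B * κ) := by gcongr
      _ = B * (κ ^ 2 * (T * S)) := by ring
      _ ≤ P := by rw [hP]; gcongr
  have e4 : |a₀ * (x₂ * κ * κ)| ≤ P := by
    simp only [abs_mul, abs_of_nonneg hκ]
    calc |a₀| * (|x₂| * κ * κ) ≤ S * (B * κ * κ) := by gcongr
      _ = B * (κ ^ 2 * (1 * S)) := by ring
      _ ≤ P := by rw [hP]; gcongr
  have e5 : |lam * D * (a₀ * x₀)| ≤ |lam| * P := by
    simp only [abs_mul]
    calc |lam| * |D| * (|a₀| * |x₀|) ≤ |lam| * (T ^ 2 * κ ^ 2) * (S * B) := by gcongr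
      _ = |lam| * (B * (κ ^ 2 * (T ^ 2 * S))) := by ring
      _ ≤ |lam| * P := by rw [hP]; gcongr
  have e6 : |2 * (m * w) * (a₁ * u * x₀)| ≤ 4 * m * P := by
    simp only [abs_mul, abs_of_nonneg hm, abs_two]
    calc 2 * (m * |w|) * (|a₁| * |u| * |x₀|) ≤ 2 * (m * |w|) * (S * (T * κ) * B) := by gcongr
      _ = 2 * m * (B * (|w| * κ * (T * S))) := by ring
      _ ≤ 2 * m * (B * (2 * r * (T ^ 2 * S))) := by gcongr
      _ = 4 * m * P := by rw [hP]; ring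
  have e7 : |2 * (m * w) * (a₀ * (x₁ * κ))| ≤ 4 * m * P := by
    simp only [abs_mul, abs_of_nonneg hm, abs_of_nonneg hκ, abs_two]
    calc 2 * (m * |w|) * (|a₀| * (|x₁| * κ)) ≤ 2 * (m * |w|) * (S * (B * κ)) := by gcongr
      _ = 2 * m * (B * (|w| * κ * (1 * S))) := by ring
      _ ≤ 2 * m * (B * (2 * r * (T ^ 2 * S))) := by gcongr
      _ = 4 * m * P := by rw [hP]; ring
  have e8 : |m * e * (a₀ * x₀)| ≤ m * P := by
    simp only [abs_mul, abs_of_nonneg hm]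
    calc m * |e| * (|a₀| * |x₀|) ≤ m * r * (S * B) := by gcongr
      _ = m * (B * (r * (1 * S))) := by ring
      _ ≤ m * P := by rw [hP]; gcongr
  have hR : B * (5 + 9 * m + |lam|) * (r * (T ^ 2 * S)) =
      (5 * P + |lam| * P) + (4 * m * P + 4 * m * P + m * P) := by rw [hP]; ring
  rw [hR]
  rw [abs_le] at e1 e2 e3 e4 e5 e6 e7 e8
  gcongr <;> rw [abs_le] <;> constructor <;> linarith [e1.1, e1.2]

theorem norm_schrodOp_weylSeq_le {p lam : ℝ} (hp : 1 ≤ p) (hlam : gammaP p < lam)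
    {h : ℝ → ℝ} (hh : ContDiff ℝ 2 h)
    (hode : ∀ t : ℝ, -(deriv (deriv h) t) + |t| ^ p * h t = gammaP p * h t)
    {χ : ℝ → ℝ} (hχ : ContDiff ℝ (⊤ : ℕ∞) χ) {B : ℝ}
    (hB : ∀ z, |χ z| ≤ B ∧ |deriv χ z| ≤ B ∧ |deriv (deriv χ) z| ≤ B)
    {k : ℕ} (hk : 1 ≤ k) (x : ℝ) {y : ℝ} (hy : y ∈ Set.Icc (k : ℝ) (2 * k)) :
    ‖schrodOp p lam (weylSeq p lam h χ k) (x, y)‖ ≤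
      (k : ℝ) ^ (-(1 : ℝ) / (p + 2)) * (B * (5 + 9 * Real.sqrt (lam - gammaP p) + |lam|) *
        ((k : ℝ) ^ (p / (p + 2) - 1) * ((1 + |x * y ^ (p / (p + 2))|) ^ 2 *
          (|h (x * y ^ (p / (p + 2)))| + |deriv h (x * y ^ (p / (p + 2)))| +
            |deriv (deriv h) (x * y ^ (p / (p + 2)))|)))) := by
  obtain ⟨hky, hyk⟩ := hy
  have hk1 : (1 : ℝ) ≤ k := by exact_mod_cast hk
  have hk0 : (0 : ℝ) < k := by linarith
  have hy0 : 0 < y := by linarith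
  set s : ℝ := p / (p + 2) with hs
  have hs0 : 0 ≤ s := by positivity
  have hs1 : s ≤ 1 := by rw [hs, div_le_one (by linarith)]; linarith
  refine (schrodOp_weylSeq hp hlam hh hode hχ k hs x hy0 rfl rfl rfl rfl).trans ?_
  have hinv : 1 / y ≤ (k : ℝ)⁻¹ := by rw [one_div]; gcongr
  have hinv0 : 0 ≤ 1 / y := by positivity
  have hs1' : |s - 1| ≤ 1 := by rw [abs_le]; constructor <;> linarith
  have hu : x * (s * y ^ (s - 1)) = s * (x * y ^ s) * (1 / y) := by
    rw [Real.rpow_sub_one hy0.ne']; ring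
  have hv : x * (s * ((s - 1) * y ^ (s - 1 - 1))) =
      s * (s - 1) * (x * y ^ s) * (1 / y) ^ 2 := by
    rw [Real.rpow_sub_one hy0.ne', Real.rpow_sub_one hy0.ne']; field_simp
  have hkr : (k : ℝ) ^ (s - 1) = (k : ℝ) ^ s * (k : ℝ)⁻¹ := by
    rw [Real.rpow_sub_one hk0.ne', div_eq_mul_inv]
  have hks : 1 ≤ (k : ℝ) ^ s := Real.one_le_rpow hk1 hs0
  have hκ1 : (k : ℝ)⁻¹ ≤ 1 := inv_le_one_of_one_le₀ hk1
  have hκ0 : 0 ≤ (k : ℝ)⁻¹ := by positivity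
  have hyr : y ^ (s - 1) ≤ (k : ℝ) ^ (s - 1) :=
    Real.rpow_le_rpow_of_nonpos hk0 hky (by linarith)
  have hys : y ^ s ≤ 2 * (k : ℝ) ^ s :=
    calc y ^ s ≤ (2 * k) ^ s := by gcongr
      _ = 2 ^ s * (k : ℝ) ^ s := Real.mul_rpow (by norm_num) hk0.le
      _ ≤ 2 ^ (1 : ℝ) * (k : ℝ) ^ s := by gcongr; norm_num
      _ = 2 * (k : ℝ) ^ s := by norm_num
  obtain ⟨b0, b1, b2⟩ := hB (y / k)
  have ht0 := abs_nonneg (x * y ^ s)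
  have n0 := abs_nonneg (h (x * y ^ s))
  have n1 := abs_nonneg (deriv h (x * y ^ s))
  have n2 := abs_nonneg (deriv (deriv h) (x * y ^ s))
  gcongr
  refine abs_add_abs_le_of_amplitude_bounds (κ := (k : ℝ)⁻¹) ?_ ?_ ?_ b0 b1 b2 ?_ hκ0 ?_ ?_ ?_ ?_
    (Real.sqrt_nonneg _) ?_ ?_
  · linarith
  · linarith
  · linarith
  · linarith
  · rw [hkr]; nlinarith
  · rw [hu, abs_mul, abs_mul, abs_of_nonneg hs0, abs_of_nonneg hinv0]
    calc s * |x * y ^ s| * (1 / y) ≤ 1 * (1 + |x * y ^ s|) * (k : ℝ)⁻¹ := by gcongr; linarith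
      _ = _ := by ring
  · rw [hv, abs_mul, abs_mul, abs_mul, abs_of_nonneg hs0, abs_of_nonneg (sq_nonneg (1 / y))]
    calc s * |s - 1| * |x * y ^ s| * (1 / y) ^ 2
        ≤ 1 * 1 * (1 + |x * y ^ s|) * ((k : ℝ)⁻¹) ^ 2 := by gcongr; linarith
      _ = _ := by ring
  · refine (abs_rpow_sq_add_sq_sub_le hs0 hs1 x hy0).trans ?_
    rw [← sq_abs (x * y ^ s)]
    calc |x * y ^ s| ^ 2 / y ^ 2 = |x * y ^ s| ^ 2 * (1 / y) ^ 2 := by field_simp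
      _ ≤ _ := by gcongr; linarith
  · rw [abs_of_nonneg (by positivity), hkr, ← mul_assoc]
    gcongr
  · rw [abs_mul, abs_of_nonneg hs0, abs_of_nonneg (by positivity)]
    calc s * y ^ (s - 1) ≤ 1 * (k : ℝ) ^ (s - 1) := by gcongr
      _ = _ := one_mul _

theorem schrodOp_weylSeq_eq_zero {p lam : ℝ} {h χ : ℝ → ℝ}
    (hχsupp : Function.support χ ⊆ Set.Icc 1 2) {k : ℕ} (hk : 1 ≤ k) (x : ℝ) {y : ℝ}
    (hy : y ∉ Set.Icc (k : ℝ) (2 * k)) :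
    schrodOp p lam (weylSeq p lam h χ k) (x, y) = 0 := by
  have hk0 : (0 : ℝ) < k := by exact_mod_cast hk
  have hz : ∀ z ∉ Set.Icc (k : ℝ) (2 * k), ∀ x, weylSeq p lam h χ k (x, z) = 0 := by
    intro z hzm x
    have : χ (z / k) = 0 := by
      by_contra hne
      have := hχsupp hne
      rw [Set.mem_Icc, le_div_iff₀ hk0, div_le_iff₀ hk0, one_mul] at this
      exact hzm this
    simp [weylSeq, this]
  have hev : (fun z => weylSeq p lam h χ k (x, z)) =ᶠ[nhds y] fun _ => 0 := by
    filter_upwards [isClosed_Icc.isOpen_compl.mem_nhds hy] with z hzm using hz z hzm x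
  have h2 : deriv (deriv fun z => weylSeq p lam h χ k (x, z)) y = 0 := by
    rw [hev.deriv.deriv_eq]; simp
  simp only [schrodOp]
  rw [h2, hz y hy x, funext (hz y hy)]
  simp

theorem two_rpow_neg_le_integral_norm_weylSeq_sq {p lam : ℝ} (hp : 1 ≤ p)
    {h : ℝ → ℝ} (hh : Continuous h) (hnorm : (∫ t : ℝ, (h t) ^ 2) = 1)
    {χ : ℝ → ℝ} (hχ : Continuous χ)
    (hχsupp : Function.support χ ⊆ Set.Icc 1 2)
    (hχnorm : (∫ z in (1 : ℝ)..2, (χ z) ^ 2) = 1) {k : ℕ} (hk : 1 ≤ k) :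
    (2 : ℝ) ^ (-(p / (p + 2))) ≤ ∫ q : ℝ × ℝ, ‖weylSeq p lam h χ k q‖ ^ 2 := by
  have hk0 : (0 : ℝ) < k := by exact_mod_cast hk
  set s : ℝ := p / (p + 2) with hs
  have hs0 : 0 ≤ s := by positivity
  have hχ0 : ∀ z, z ∉ Set.Icc (1 : ℝ) 2 → χ z = 0 := fun z hz => by
    by_contra hne; exact hz (hχsupp hne)
  have hh2 : Integrable fun t => h t ^ 2 := by
    by_contra hni; rw [integral_undef hni] at hnorm; norm_num at hnorm
  have hc : ContinuousOn (fun z : ℝ => z ^ (-s) * χ z ^ 2) (Set.Icc 1 2) :=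
    (ContinuousOn.rpow_const continuousOn_id fun z hz =>
      Or.inl (by have := hz.1; simp only [id]; linarith)).mul (hχ.pow 2).continuousOn
  have hsub : Function.support (fun z : ℝ => z ^ (-s) * χ z ^ 2) ⊆ Set.Icc 1 2 := fun z hz => by
    by_contra hn; exact hz (by simp [hχ0 z hn])
  have hint : Integrable fun z : ℝ => z ^ (-s) * χ z ^ 2 :=
    (integrableOn_iff_integrable_of_support_subset hsub).1 (hc.integrableOn_compact isCompact_Icc)
  have hlow : (2 : ℝ) ^ (-s) ≤ ∫ z, z ^ (-s) * χ z ^ 2 := by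
    have h2 : ∫ z, z ^ (-s) * χ z ^ 2 = ∫ z in (1 : ℝ)..2, z ^ (-s) * χ z ^ 2 := by
      rw [intervalIntegral.integral_of_le (by norm_num), ← integral_Icc_eq_integral_Ioc,
        setIntegral_eq_integral_of_forall_compl_eq_zero]
      intro z hz
      simp [hχ0 z hz]
    rw [h2]
    calc (2 : ℝ) ^ (-s) = ∫ z in (1 : ℝ)..2, (2 : ℝ) ^ (-s) * χ z ^ 2 := by
          rw [intervalIntegral.integral_const_mul, hχnorm, mul_one]
      _ ≤ _ := by
          refine intervalIntegral.integral_mono_on (by norm_num)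
            ((continuous_const.mul (hχ.pow 2)).intervalIntegrable _ _)
            hint.intervalIntegrable fun z hz => ?_
          have := Real.rpow_le_rpow_of_nonpos (by linarith [hz.1]) hz.2 (neg_nonpos.2 hs0)
          gcongr
  set c : ℝ := (k : ℝ) ^ (-(1 : ℝ) / (p + 2))
  have hc2 : c ^ 2 = (k : ℝ) ^ (s - 1) := sq_rpow_neg_one_div_add_two hp hk0
  have hscale : (fun y : ℝ => y ^ (-s) * (c ^ 2 * χ (y / k) ^ 2)) =
      fun y => (k : ℝ)⁻¹ * ((y / k) ^ (-s) * χ (y / k) ^ 2) := by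
    funext y
    by_cases hy : y / k ∈ Set.Icc (1 : ℝ) 2
    · have hy0 : 0 < y := by
        by_contra hn
        have := div_nonpos_of_nonpos_of_nonneg (not_lt.1 hn) hk0.le
        linarith [hy.1]
      rw [hc2, Real.div_rpow hy0.le hk0.le, Real.rpow_neg hk0.le, Real.rpow_sub_one hk0.ne']
      field_simp
    · simp [hχ0 _ hy]
  have hW : Integrable fun y : ℝ => y ^ (-s) * (c ^ 2 * χ (y / k) ^ 2) := by
    rw [hscale]
    exact (hint.comp_div hk0.ne').const_mul _
  have heq : ∀ q : ℝ × ℝ, ‖weylSeq p lam h χ k q‖ ^ 2 =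
      h (q.1 * q.2 ^ s) ^ 2 * (c ^ 2 * χ (q.2 / k) ^ 2) := by
    intro q
    rcases le_or_gt q.2 0 with hq | hq
    · have : χ (q.2 / k) = 0 := hχ0 _ fun hm => by
        have := div_nonpos_of_nonpos_of_nonneg hq hk0.le
        linarith [hm.1]
      simp [weylSeq, not_lt.2 hq, this]
    · rw [norm_weylSeq hq, sq_abs]; ring
  have hmain := (integral_comp_mul_rpow_mul (F := fun t => h t ^ 2)
    (W := fun y => c ^ 2 * χ (y / k) ^ 2) s (hh.pow 2) hh2
    (by fun_prop) (fun y hy => by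
      rw [hχ0 (y / k) fun hm => ?_]
      · simp
      · have := div_nonpos_of_nonpos_of_nonneg hy hk0.le
        linarith [hm.1]) hW).2
  simp only [heq]
  rw [hmain, hnorm, one_mul, hscale, integral_const_mul,
    Measure.integral_comp_div (fun z : ℝ => z ^ (-s) * χ z ^ 2), abs_of_pos hk0, smul_eq_mul,
    ← mul_assoc, inv_mul_cancel₀ hk0.ne', one_mul]
  exact hlow

/-- For `p ≥ 1`, `λ > γ_p`, a (polynomially weighted-`L²`) ground state `h` of the
anharmonic oscillator `-h'' + |t|^p h = γ_p h` with `∫ h² = 1`, and a smooth `χ`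
supported in `[1,2]` with `∫_1^2 χ² = 1`, the Weyl sequence `ψ_k` satisfies
`∫ |ψ_k|² ≥ 2^{-p/(p+2)}` for all `k ≥ 1` and `‖L_p(λ)ψ_k‖_{L²}² → 0` as `k → ∞`. -/
theorem weylSeq_norm_lowerBound_and_opNorm_tendsto_zero
    (p lam : ℝ) (hp : 1 ≤ p) (hlam : gammaP p < lam)
    (h : ℝ → ℝ) (hh : ContDiff ℝ 2 h)
    (hode : ∀ t : ℝ, -(deriv (deriv h) t) + |t| ^ p * h t = gammaP p * h t)
    (hnorm : (∫ t : ℝ, (h t) ^ 2) = 1)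
    (hweight : ∀ N : ℕ, Integrable (fun t : ℝ =>
      (1 + |t|) ^ (2 * N) *
        ((h t) ^ 2 + (deriv h t) ^ 2 + (deriv (deriv h) t) ^ 2)))
    (χ : ℝ → ℝ) (hχ : ContDiff ℝ (⊤ : ℕ∞) χ)
    (hχsupp : Function.support χ ⊆ Set.Icc 1 2)
    (hχnorm : (∫ z in (1 : ℝ)..2, (χ z) ^ 2) = 1) :
    (∀ k : ℕ, 1 ≤ k →
      (2 : ℝ) ^ (-(p / (p + 2))) ≤ ∫ q : ℝ × ℝ, ‖weylSeq p lam h χ k q‖ ^ 2) ∧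
    Tendsto (fun k : ℕ =>
        ∫ q : ℝ × ℝ, ‖schrodOp p lam (weylSeq p lam h χ k) q‖ ^ 2)
      atTop (nhds 0) := by
  have hh0 : Continuous h := hh.continuous
  refine ⟨fun k hk => two_rpow_neg_le_integral_norm_weylSeq_sq hp hh0 hnorm hχ.continuous
    hχsupp hχnorm hk, ?_⟩
  obtain ⟨B, hB0, hB⟩ := exists_forall_abs_le_of_support_subset_Icc hχ hχsupp
  set s : ℝ := p / (p + 2) with hs
  have hs0 : 0 ≤ s := by positivity
  have hs1 : s < 1 := by rw [hs, div_lt_one (by linarith)]; linarith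
  set K : ℝ := B * (5 + 9 * Real.sqrt (lam - gammaP p) + |lam|) with hK
  set M : ℝ → ℝ := fun t => (1 + |t|) ^ (2 * 2) *
    ((h t) ^ 2 + (deriv h t) ^ 2 + (deriv (deriv h) t) ^ 2) with hM
  have hh1 : Continuous (deriv h) := hh.continuous_deriv (by norm_num)
  have hh2 : Continuous (deriv (deriv h)) := 
    (ContDiff.deriv' (n := 1) hh).continuous_deriv le_rfl
  have hMc : Continuous M := by fun_prop
  have hMi : Integrable M := hweight 2
  have hM0 : ∀ t, 0 ≤ M t := fun t => by positivity
  have hbound : ∀ k : ℕ, 1 ≤ k →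
      ∫ q : ℝ × ℝ, ‖schrodOp p lam (weylSeq p lam h χ k) q‖ ^ 2 ≤
        3 * K ^ 2 * (∫ t, M t) * ((k : ℝ) ^ (s - 1)) ^ 2 := by
    intro k hk
    have hk0 : (0 : ℝ) < k := by exact_mod_cast hk
    set c : ℝ := (k : ℝ) ^ (-(1 : ℝ) / (p + 2))
    have hc2 : c ^ 2 = (k : ℝ) ^ (s - 1) := sq_rpow_neg_one_div_add_two hp hk0
    set A : ℝ := c ^ 2 * (3 * K ^ 2 * ((k : ℝ) ^ (s - 1)) ^ 2) with hA
    have hA0 : 0 ≤ A := by positivity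
    set W : ℝ → ℝ := (Set.Icc (k : ℝ) (2 * k)).indicator fun _ => A with hWdef
    have hWr : (fun y : ℝ => y ^ (-s) * W y) =
        (Set.Icc (k : ℝ) (2 * k)).indicator fun y => y ^ (-s) * A := by
      funext y
      by_cases hy : y ∈ Set.Icc (k : ℝ) (2 * k) <;> simp [hWdef, hy]
    have hWi : Integrable fun y : ℝ => y ^ (-s) * W y := by
      rw [hWr, integrable_indicator_iff measurableSet_Icc]
      refine ContinuousOn.integrableOn_compact isCompact_Icc ?_
      exact (ContinuousOn.rpow_const continuousOn_id fun z hz =>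
        Or.inl (by have := hz.1; simp only [id]; linarith)).mul continuousOn_const
    have hWle : ∫ y : ℝ, y ^ (-s) * W y ≤ (k : ℝ) ^ (1 - s) * A := by
      calc ∫ y : ℝ, y ^ (-s) * W y
          ≤ ∫ y : ℝ, (Set.Icc (k : ℝ) (2 * k)).indicator (fun _ => (k : ℝ) ^ (-s) * A) y := by
            refine integral_mono hWi ?_ ?_
            · rw [integrable_indicator_iff measurableSet_Icc]
              exact integrableOn_const (by simp)
            · rw [hWr]
              intro y
              refine Set.indicator_le_indicator' fun hy => ?_
              have := Real.rpow_le_rpow_of_nonpos hk0 hy.1 (neg_nonpos.2 hs0)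
              gcongr
        _ = (k : ℝ) ^ (1 - s) * A := by
            rw [integral_indicator_const _ measurableSet_Icc, Real.volume_real_Icc_of_le
              (by linarith), sub_eq_add_neg 1 s, Real.rpow_add hk0, Real.rpow_one, smul_eq_mul]
            ring
    obtain ⟨hi, heq⟩ := integral_comp_mul_rpow_mul (W := W) s hMc hMi
      (measurable_const.indicator measurableSet_Icc)
      (fun y hy => Set.indicator_of_notMem (fun hm => by linarith [hm.1]) _) hWi
    calc ∫ q : ℝ × ℝ, ‖schrodOp p lam (weylSeq p lam h χ k) q‖ ^ 2
        ≤ ∫ q : ℝ × ℝ, M (q.1 * q.2 ^ s) * W q.2 := by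
          refine integral_mono_of_nonneg (Eventually.of_forall fun q => by positivity) hi
            (Eventually.of_forall ?_)
          rintro ⟨x, y⟩
          by_cases hy : y ∈ Set.Icc (k : ℝ) (2 * k)
          · have h1 := norm_schrodOp_weylSeq_le hp hlam hh hode hχ hB hk x hy
            simp only [← hs] at h1
            set t := x * y ^ s
            simp only [hWdef, Set.indicator_of_mem hy, hA, hM]
            refine (pow_le_pow_left₀ (norm_nonneg _) h1 2).trans ?_
            have h3 : (|h t| + |deriv h t| + |deriv (deriv h) t|) ^ 2 ≤
                3 * ((h t) ^ 2 + (deriv h t) ^ 2 + (deriv (deriv h) t) ^ 2) := by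
              rw [← sq_abs (h t), ← sq_abs (deriv h t), ← sq_abs (deriv (deriv h) t)]
              nlinarith [sq_nonneg (|h t| - |deriv h t|),
                sq_nonneg (|h t| - |deriv (deriv h) t|),
                sq_nonneg (|deriv h t| - |deriv (deriv h) t|)]
            calc _ = c ^ 2 * K ^ 2 * ((k : ℝ) ^ (s - 1)) ^ 2 * (1 + |t|) ^ (2 * 2) *
                  (|h t| + |deriv h t| + |deriv (deriv h) t|) ^ 2 := by ring
              _ ≤ c ^ 2 * K ^ 2 * ((k : ℝ) ^ (s - 1)) ^ 2 * (1 + |t|) ^ (2 * 2) *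
                  (3 * ((h t) ^ 2 + (deriv h t) ^ 2 + (deriv (deriv h) t) ^ 2)) := by gcongr
              _ = _ := by ring
          · simp [hWdef, hy, schrodOp_weylSeq_eq_zero hχsupp hk x hy]
      _ = (∫ t, M t) * ∫ y, y ^ (-s) * W y := heq
      _ ≤ (∫ t, M t) * ((k : ℝ) ^ (1 - s) * A) := by
          have := (integral_nonneg hM0 : 0 ≤ ∫ t, M t)
          gcongr
      _ = 3 * K ^ 2 * (∫ t, M t) * ((k : ℝ) ^ (s - 1)) ^ 2 := by
          have h1 : (k : ℝ) ^ (1 - s) * (k : ℝ) ^ (s - 1) = 1 := by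
            rw [← Real.rpow_add hk0]; simp
          rw [hA, hc2]
          linear_combination (∫ t, M t) * (3 * K ^ 2 * ((k : ℝ) ^ (s - 1)) ^ 2) * h1
  have hlim : Tendsto (fun k : ℕ => 3 * K ^ 2 * (∫ t, M t) * ((k : ℝ) ^ (s - 1)) ^ 2)
      atTop (nhds 0) := by
    have h1 : Tendsto (fun k : ℕ => (k : ℝ) ^ (s - 1)) atTop (nhds 0) := by
      have := (tendsto_rpow_neg_atTop (y := 1 - s) (by linarith)).comp
        (tendsto_natCast_atTop_atTop (R := ℝ))
      simpa [Function.comp_def] using this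
    simpa using (h1.pow 2).const_mul (3 * K ^ 2 * ∫ t, M t)
  refine tendsto_of_tendsto_of_tendsto_of_le_of_le' tendsto_const_nhds hlim
    (Eventually.of_forall fun k => integral_nonneg fun q => by positivity) ?_
  filter_upwards [eventually_ge_atTop 1] with k hk using hbound k hk
end

section
/- Let p ≥ 1 and let l_{k,p} denote the Neumann realization of −d²/dx² + |x|^p on the interval [−k, k]. Then inf σ(l_{k,p}) ≥ γ_p + o(k^{−p/2}) as k → ∞. Equivalently, in variational form: for every ε > 0 there exists K > 0 such that for all k ≥ K and every ψ ∈ C¹([−k,k]) with ∫_{−k}^{k} |ψ(x)|² dx = 1, one has ∫_{−k}^{k} (|ψ'(x)|² + |x|^p |ψ(x)|²) dx ≥ γ_p − ε k^{−p/2}. -/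
open MeasureTheory Filter

open scoped Topology ContDiff Convolution

/-- A compactly supported `C¹` function is a limit of smooth functions, in the `C¹` sense and with
uniformly bounded supports, values and derivatives. -/
theorem exists_smooth_approx {u : ℝ → ℝ} (hu : ContDiff ℝ 1 u) {R : ℝ}
    (hR : ∀ x, R < |x| → u x = 0) :
    ∃ (v : ℕ → ℝ → ℝ) (M : ℝ), (∀ n, ContDiff ℝ ∞ (v n)) ∧
      (∀ n x, R + 1 < |x| → v n x = 0) ∧
      (∀ n x, |v n x| ≤ M) ∧ (∀ n x, |deriv (v n) x| ≤ M) ∧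
      (∀ x, Tendsto (fun n => v n x) atTop (𝓝 (u x))) ∧
      (∀ x, Tendsto (fun n => deriv (v n) x) atTop (𝓝 (deriv u x))) := by
  have hcs : HasCompactSupport u :=
    HasCompactSupport.intro (isCompact_Icc (a := -R) (b := R)) fun x hx =>
      hR x (by contrapose! hx; exact abs_le.1 hx)
  have hdc : Continuous (deriv u) := hu.continuous_deriv le_rfl
  obtain ⟨A, hA⟩ := hcs.exists_bound_of_continuous hu.continuous
  obtain ⟨B, hB⟩ := hcs.deriv.exists_bound_of_continuous hdc
  simp only [Real.norm_eq_abs] at hA hB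
  let φ : ℕ → ContDiffBump (0 : ℝ) := fun n =>
    ⟨1 / (2 * ((n : ℝ) + 1)), 1 / ((n : ℝ) + 1), by positivity,
      one_div_lt_one_div_of_lt (by positivity) (by nlinarith [n.cast_nonneg (α := ℝ)])⟩
  have hφ : Tendsto (fun n => (φ n).rOut) atTop (𝓝 0) := tendsto_one_div_add_atTop_nhds_zero_nat
  have hφ1 : ∀ n, (φ n).rOut ≤ 1 := fun n =>
    (div_le_one (by positivity)).2 (by linarith [n.cast_nonneg (α := ℝ)])
  let L := ContinuousLinearMap.lsmul ℝ ℝ (E := ℝ)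
  have hφi : ∀ n, LocallyIntegrable ((φ n).normed volume) volume := fun n =>
    (φ n).continuous_normed.locallyIntegrable
  have hderiv : ∀ n, deriv ((φ n).normed volume ⋆[L, volume] u) =
      (φ n).normed volume ⋆[L, volume] deriv u := fun n =>
    funext fun x => (hcs.hasDerivAt_convolution_right L (hφi n) hu x).deriv
  have hbound : ∀ (g : ℝ → ℝ) (C : ℝ), Continuous g → (∀ x, |g x| ≤ C) → ∀ n x,
      |((φ n).normed volume ⋆[L, volume] g) x| ≤ 3 * C := by
    intro g C hg hC n x
    have h : dist (((φ n).normed volume ⋆[L, volume] g) x) (g x) ≤ 2 * C :=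
      (φ n).dist_normed_convolution_le hg.aestronglyMeasurable fun y _ => by
        rw [Real.dist_eq]
        linarith [abs_sub (g y) (g x), hC x, hC y]
    rw [Real.dist_eq] at h
    have := abs_sub_abs_le_abs_sub (((φ n).normed volume ⋆[L, volume] g) x) (g x)
    linarith [hC x]
  refine ⟨fun n => (φ n).normed volume ⋆[L, volume] u, 3 * max A B, fun n => ?_, fun n x hx => ?_,
    hbound u _ hu.continuous fun x => (hA x).trans (le_max_left _ _), fun n => ?_, fun x => ?_,
    fun x => ?_⟩
  · exact (φ n).hasCompactSupport_normed.contDiff_convolution_left L (φ n).contDiff_normed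
      hu.continuous.locallyIntegrable
  · have hx0 : u x = 0 := hR x (by linarith)
    have h := (φ n).dist_normed_convolution_le (μ := volume) (ε := 0) (x₀ := x)
      hu.continuous.aestronglyMeasurable fun y hy => by
        rw [Metric.mem_ball, Real.dist_eq] at hy
        have := abs_sub_abs_le_abs_sub x y
        rw [abs_sub_comm] at this
        rw [hx0, hR y (by linarith [hφ1 n]), dist_self]
    rw [hx0] at h
    exact dist_le_zero.1 h
  · rw [hderiv]
    exact hbound _ (max A B) hdc (fun x => (hB x).trans (le_max_right _ _)) n
  · exact ContDiffBump.convolution_tendsto_right_of_continuous hφ hu.continuous x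
  · simp only [hderiv]
    exact ContDiffBump.convolution_tendsto_right_of_continuous hφ hdc x

theorem gammaP_nonneg (p : ℝ) : 0 ≤ gammaP p := by
  refine Real.sInf_nonneg ?_
  rintro E ⟨u, -, -, -, rfl⟩
  exact integral_nonneg fun t => by positivity

theorem gammaP_mul_integral_sq_le_of_smooth (p : ℝ) {u : ℝ → ℝ} (hu : ContDiff ℝ ∞ u)
    (hcs : HasCompactSupport u) :
    gammaP p * ∫ t, u t ^ 2 ≤ ∫ t, (deriv u t ^ 2 + |t| ^ p * u t ^ 2) := by
  rcases (integral_nonneg fun t => sq_nonneg (u t) : 0 ≤ ∫ t, u t ^ 2).eq_or_lt with h0 | h0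
  · rw [← h0, mul_zero]
    exact integral_nonneg fun t => by positivity
  set m := ∫ t, u t ^ 2 with hm
  have hs : (√m)⁻¹ ^ 2 = m⁻¹ := by rw [inv_pow, Real.sq_sqrt h0.le]
  have hle : gammaP p ≤ m⁻¹ * ∫ t, (deriv u t ^ 2 + |t| ^ p * u t ^ 2) := by
    refine csInf_le ⟨0, ?_⟩ ⟨fun t => (√m)⁻¹ * u t, contDiff_const.mul hu, hcs.mul_left, ?_, ?_⟩
    · rintro E ⟨u, -, -, -, rfl⟩
      exact integral_nonneg fun t => by positivity
    · simp only [mul_pow, hs]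
      rw [integral_const_mul, ← hm, inv_mul_cancel₀ h0.ne']
    · rw [← integral_const_mul]
      congr 1
      ext t
      rw [deriv_const_mul _ (hu.differentiable (by simp) t), mul_pow, mul_pow, hs]
      ring
  rwa [inv_mul_eq_div, le_div_iff₀ h0] at hle

/-- The variational inequality defining `gammaP` extends to compactly supported `C¹` functions. -/
theorem gammaP_mul_integral_sq_le {p : ℝ} (hp : 0 < p) {u : ℝ → ℝ} (hu : ContDiff ℝ 1 u)
    {R : ℝ} (hR : ∀ x, R < |x| → u x = 0) :
    gammaP p * ∫ t, u t ^ 2 ≤ ∫ t, (deriv u t ^ 2 + |t| ^ p * u t ^ 2) := by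
  obtain ⟨v, M, hv, hvR, hvM, hvM', hlim, hlim'⟩ := exists_smooth_approx hu hR
  have hV : Continuous fun t : ℝ => |t| ^ p := continuous_abs.rpow_const fun _ => Or.inr hp.le
  have hd : ∀ n, Continuous (deriv (v n)) := fun n => (hv n).continuous_deriv (by simp)
  have hcs : ∀ n, HasCompactSupport (v n) := fun n =>
    HasCompactSupport.intro (isCompact_Icc (a := -(R + 1)) (b := R + 1)) fun x hx =>
      hvR n x (by contrapose! hx; exact abs_le.1 hx)
  have hvd : ∀ n x, R + 1 < |x| → deriv (v n) x = 0 := by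
    intro n x hx
    have : v n =ᶠ[𝓝 x] fun _ => 0 := by
      filter_upwards [(isOpen_lt continuous_const continuous_abs).mem_nhds hx] with y hy
      exact hvR n y hy
    rw [this.deriv_eq, deriv_const]
  let s := Set.Icc (-(R + 1)) (R + 1)
  have hs : ∀ x, x ∉ s → R + 1 < |x| := fun x hx => by contrapose! hx; exact abs_le.1 hx
  have hint : ∀ g : ℝ → ℝ, Continuous g → Integrable (s.indicator g) := fun g hg =>
    (integrable_indicator_iff measurableSet_Icc).2
      (hg.continuousOn.integrableOn_compact isCompact_Icc)
  have hsq : ∀ a : ℝ, |a| ≤ M → a ^ 2 ≤ M ^ 2 := fun a ha =>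
    sq_le_sq' (neg_le_of_abs_le ha) (le_of_abs_le ha)
  have h1 : Tendsto (fun n => ∫ t, v n t ^ 2) atTop (𝓝 (∫ t, u t ^ 2)) := by
    refine tendsto_integral_of_dominated_convergence (s.indicator fun _ => M ^ 2)
      (fun n => ((hv n).continuous.pow 2).aestronglyMeasurable) (hint _ continuous_const)
      (fun n => ae_of_all _ fun x => ?_) (ae_of_all _ fun x => (hlim x).pow 2)
    by_cases hx : x ∈ s
    · rw [Set.indicator_of_mem hx, Real.norm_of_nonneg (sq_nonneg _)]
      exact hsq _ (hvM n x)
    · rw [Set.indicator_of_notMem hx, hvR n x (hs x hx)]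
      simp
  have h2 : Tendsto (fun n => ∫ t, (deriv (v n) t ^ 2 + |t| ^ p * v n t ^ 2)) atTop
      (𝓝 (∫ t, (deriv u t ^ 2 + |t| ^ p * u t ^ 2))) := by
    refine tendsto_integral_of_dominated_convergence
      (s.indicator fun t => M ^ 2 + |t| ^ p * M ^ 2)
      (fun n => (((hd n).pow 2).add (hV.mul ((hv n).continuous.pow 2))).aestronglyMeasurable)
      (hint _ (continuous_const.add (hV.mul continuous_const)))
      (fun n => ae_of_all _ fun x => ?_)
      (ae_of_all _ fun x => ((hlim' x).pow 2).add (((hlim x).pow 2).const_mul _))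
    by_cases hx : x ∈ s
    · rw [Set.indicator_of_mem hx, Real.norm_of_nonneg (by positivity)]
      exact add_le_add (hsq _ (hvM' n x))
        (mul_le_mul_of_nonneg_left (hsq _ (hvM n x)) (by positivity))
    · rw [Set.indicator_of_notMem hx, hvR n x (hs x hx), hvd n x (hs x hx)]
      simp
  exact le_of_tendsto_of_tendsto' (h1.const_mul _) h2 fun n =>
    gammaP_mul_integral_sq_le_of_smooth p (hv n) (hcs n)

/-- A smooth angle function vanishing near the origin and equal to `π / 2` away from it. -/
theorem exists_cutoff_angle :
    ∃ (Θ : ℝ → ℝ) (C : ℝ), ContDiff ℝ ∞ Θ ∧ (∀ y, |y| ≤ 1 / 2 → Θ y = 0) ∧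
      (∀ y, 3 / 4 ≤ |y| → Θ y = Real.pi / 2) ∧ ∀ y, |deriv Θ y| ≤ C := by
  let f : ContDiffBump (0 : ℝ) := ⟨1 / 2, 3 / 4, by norm_num, by norm_num⟩
  have hf : ContDiff ℝ ∞ f := f.contDiff
  obtain ⟨C, hC⟩ := f.hasCompactSupport.deriv.exists_bound_of_continuous
    (hf.continuous_deriv (by simp))
  refine ⟨fun y => Real.pi / 2 * (1 - f y), Real.pi / 2 * C,
    contDiff_const.mul (contDiff_const.sub hf), fun y hy => ?_, fun y hy => ?_, fun y => ?_⟩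
  · have : f y = 1 := f.one_of_mem_closedBall (by simpa [f] using hy)
    simp [this]
  · have : f y = 0 := f.zero_of_le_dist (by simpa [f] using hy)
    simp [this]
  · have hd : DifferentiableAt ℝ f y := hf.differentiable (by simp) y
    have h : deriv (fun y => Real.pi / 2 * (1 - f y)) y = Real.pi / 2 * -deriv f y :=
      ((hd.hasDerivAt.const_sub 1).const_mul _).deriv
    rw [h, abs_mul, abs_neg, abs_of_pos (by positivity)]
    exact mul_le_mul_of_nonneg_left (hC y) (by positivity)

/-- Localization: cutting off a function on `[-k, k]` by the cosine of an angle `θ` bounds its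
energy from below by `gammaP p`, up to a relative error controlled by `θ' ^ 2`. -/
theorem gammaP_le_one_add_mul_energy {p k R δ : ℝ} (hp : 0 < p) (hk : 0 < k) (hRk : R < k)
    (hδ0 : 0 ≤ δ)
    {θ : ℝ → ℝ} (hθ : ContDiff ℝ 1 θ) (hθR : ∀ x, R ≤ |x| → Real.cos (θ x) = 0)
    (hθγ : ∀ x, θ x = 0 ∨ gammaP p ≤ |x| ^ p)
    (hδ : ∀ x, deriv θ x ^ 2 ≤ δ * |x| ^ p)
    {ψ : ℝ → ℝ} (hψ : ContDiffOn ℝ 1 ψ (Set.Icc (-k) k))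
    (hn : ∫ x in Set.Icc (-k) k, ψ x ^ 2 = 1) :
    gammaP p ≤ (1 + δ) * ∫ x in Set.Icc (-k) k, (deriv ψ x ^ 2 + |x| ^ p * ψ x ^ 2) := by
  have hV : Continuous fun t : ℝ => |t| ^ p := continuous_abs.rpow_const fun _ => Or.inr hp.le
  have hmem : ∀ x ∈ Set.Ioo (-k) k, Set.Icc (-k) k ∈ 𝓝 x := fun x hx => Icc_mem_nhds hx.1 hx.2
  let φ : ℝ → ℝ := fun x => Real.cos (θ x) * ψ x
  have hφR : ∀ x, R < |x| → φ x = 0 := fun x hx => by simp [φ, hθR x hx.le]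
  have hφ : ContDiff ℝ 1 φ := by
    refine contDiff_iff_contDiffAt.2 fun x => ?_
    rcases lt_or_ge |x| k with hx | hx
    · exact (Real.contDiff_cos.comp hθ).contDiffAt.mul (hψ.contDiffAt (hmem x (abs_lt.1 hx)))
    · have : φ =ᶠ[𝓝 x] fun _ => 0 := by
        filter_upwards [(isOpen_lt continuous_const continuous_abs).mem_nhds (hRk.trans_le hx)]
          with y hy
        exact hφR y hy
      exact contDiffAt_const.congr_of_eventuallyEq this
  have hφd : ∀ x ∈ Set.Ioo (-k) k,
      deriv φ x = -Real.sin (θ x) * deriv θ x * ψ x + Real.cos (θ x) * deriv ψ x := by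
    intro x hx
    have hθx := (hθ.differentiable one_ne_zero x).hasDerivAt
    have hψx := ((hψ.contDiffAt (hmem x hx)).differentiableAt one_ne_zero).hasDerivAt
    exact (hθx.cos.mul hψx).deriv
  have hφk : ∀ x, x ∉ Set.Ioo (-k) k → R < |x| := fun x hx => by
    contrapose! hx
    exact abs_lt.1 (hx.trans_lt hRk)
  have hφd0 : ∀ x, x ∉ Set.Ioo (-k) k → deriv φ x = 0 := by
    intro x hx
    have : φ =ᶠ[𝓝 x] fun _ => 0 := by
      filter_upwards [(isOpen_lt continuous_const continuous_abs).mem_nhds (hφk x hx)] with y hy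
      exact hφR y hy
    rw [this.deriv_eq, deriv_const]
  have hint : ∀ g : ℝ → ℝ, ContinuousOn g (Set.Icc (-k) k) → IntegrableOn g (Set.Ioo (-k) k) :=
    fun g hg => (hg.integrableOn_compact isCompact_Icc).mono_set Set.Ioo_subset_Icc_self
  have hψ2 : ContinuousOn (fun x => ψ x ^ 2) (Set.Icc (-k) k) := hψ.continuousOn.pow 2
  have hVψ : IntegrableOn (fun x => |x| ^ p * ψ x ^ 2) (Set.Ioo (-k) k) :=
    hint _ (hV.continuousOn.mul hψ2)
  have hψ' : IntegrableOn (fun x => deriv ψ x ^ 2) (Set.Ioo (-k) k) := by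
    refine (hint _ ((hψ.continuousOn_derivWithin (uniqueDiffOn_Icc (by linarith))
      le_rfl).pow 2)).congr_fun (fun x hx => ?_) measurableSet_Ioo
    rw [Pi.pow_apply, derivWithin_of_mem_nhds (hmem x hx)]
  have hE : IntegrableOn (fun x => deriv ψ x ^ 2 + |x| ^ p * ψ x ^ 2) (Set.Ioo (-k) k) :=
    hψ'.add hVψ
  have hφc : Continuous fun x => deriv φ x ^ 2 + |x| ^ p * φ x ^ 2 :=
    ((hφ.continuous_deriv le_rfl).pow 2).add (hV.mul (hφ.continuous.pow 2))
  have hφ2 : Continuous fun x => gammaP p * φ x ^ 2 := continuous_const.mul (hφ.continuous.pow 2)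
  have key := gammaP_mul_integral_sq_le hp hφ hφR
  have hsupp : ∫ x in Set.Ioo (-k) k, gammaP p * φ x ^ 2 = ∫ x, gammaP p * φ x ^ 2 :=
    setIntegral_eq_integral_of_forall_compl_eq_zero fun x hx => by simp [hφR x (hφk x hx)]
  have hsupp' : ∫ x in Set.Ioo (-k) k, (deriv φ x ^ 2 + |x| ^ p * φ x ^ 2) =
      ∫ x, (deriv φ x ^ 2 + |x| ^ p * φ x ^ 2) :=
    setIntegral_eq_integral_of_forall_compl_eq_zero fun x hx => by
      simp [hφR x (hφk x hx), hφd0 x hx]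
  rw [← integral_const_mul, ← hsupp, ← hsupp'] at key
  simp only [integral_Icc_eq_integral_Ioo] at hn ⊢
  have hle : ∫ x in Set.Ioo (-k) k,
        ((deriv φ x ^ 2 + |x| ^ p * φ x ^ 2) - gammaP p * φ x ^ 2) ≤
      ∫ x in Set.Ioo (-k) k,
        ((1 + δ) * (deriv ψ x ^ 2 + |x| ^ p * ψ x ^ 2) - gammaP p * ψ x ^ 2) := by
    refine setIntegral_mono_on ((hint _ hφc.continuousOn).sub (hint _ hφ2.continuousOn))
      ((hE.const_mul (1 + δ)).sub ((hint _ hψ2).const_mul _)) measurableSet_Ioo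
      fun x hx => ?_
    have hsc := Real.sin_sq_add_cos_sq (θ x)
    have h1 : deriv φ x ^ 2 ≤ deriv ψ x ^ 2 + δ * |x| ^ p * ψ x ^ 2 := by
      have h2 : deriv φ x ^ 2 ≤ deriv ψ x ^ 2 + deriv θ x ^ 2 * ψ x ^ 2 := by
        have : deriv ψ x ^ 2 + deriv θ x ^ 2 * ψ x ^ 2 - deriv φ x ^ 2 =
            (Real.sin (θ x) * deriv ψ x + Real.cos (θ x) * (deriv θ x * ψ x)) ^ 2 := by
          rw [hφd x hx]
          linear_combination (-(deriv ψ x ^ 2 + deriv θ x ^ 2 * ψ x ^ 2)) * hsc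
        nlinarith [sq_nonneg
          (Real.sin (θ x) * deriv ψ x + Real.cos (θ x) * (deriv θ x * ψ x))]
      nlinarith [mul_le_mul_of_nonneg_right (hδ x) (sq_nonneg (ψ x))]
    have h3 : 0 ≤ (|x| ^ p - gammaP p) * (Real.sin (θ x) ^ 2 * ψ x ^ 2) := by
      rcases hθγ x with h | h
      · simp [h]
      · exact mul_nonneg (sub_nonneg.2 h) (by positivity)
    have h4 : φ x ^ 2 = ψ x ^ 2 - Real.sin (θ x) ^ 2 * ψ x ^ 2 := by
      simp only [φ]
      linear_combination ψ x ^ 2 * hsc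
    rw [h4]
    nlinarith [mul_nonneg hδ0 (sq_nonneg (deriv ψ x))]
  rw [integral_sub (hint _ hφc.continuousOn) (hint _ hφ2.continuousOn),
    integral_sub (hE.const_mul (1 + δ)) ((hint _ hψ2).const_mul _),
    integral_const_mul (1 + δ), integral_const_mul (gammaP p) (fun x => ψ x ^ 2), hn] at hle
  linarith

/-- The ground-state energy of the Neumann realization `l_{k,p}` of
`-d²/dx² + |x|^p` on `[-k,k]` is bounded below by `γ_p + o(k^{-p/2})` as `k → ∞`,
in variational form: for every `ε > 0` there is `K > 0` such that for all `k ≥ K`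
and every normalized `ψ ∈ C¹([-k,k])` one has
`∫_{-k}^{k} (|ψ'|² + |x|^p |ψ|²) ≥ γ_p − ε k^{-p/2}`. -/
theorem neumann_groundState_lowerBound (p : ℝ) (hp : 1 ≤ p) :
    ∀ ε : ℝ, 0 < ε → ∃ K : ℝ, 0 < K ∧ ∀ k : ℝ, K ≤ k →
      ∀ ψ : ℝ → ℝ, ContDiffOn ℝ 1 ψ (Set.Icc (-k) k) →
        (∫ x in Set.Icc (-k) k, (ψ x) ^ 2) = 1 →
        gammaP p - ε * k ^ (-(p / 2)) ≤
          ∫ x in Set.Icc (-k) k, ((deriv ψ x) ^ 2 + |x| ^ p * (ψ x) ^ 2) := by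
  intro ε hε
  obtain ⟨Θ, C, hΘ, hΘ0, hΘ1, hC⟩ := exists_cutoff_angle
  set γ := gammaP p with hγ
  have hγ0 : 0 ≤ γ := gammaP_nonneg p
  have hp0 : 0 < p := by linarith
  refine ⟨max (2 * (γ + 1)) (C ^ 2 * 2 ^ p * γ / ε + 1), lt_max_of_lt_left (by linarith),
    fun k hk ψ hψ hn => ?_⟩
  have hk1 : 2 * (γ + 1) ≤ k := (le_max_left _ _).trans hk
  have hk2 : C ^ 2 * 2 ^ p * γ / ε + 1 ≤ k := (le_max_right _ _).trans hk
  have hk0 : 0 < k := by linarith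
  set δ := C ^ 2 * 2 ^ p * k ^ (-p) / k ^ 2 with hδ
  have hδ0 : 0 ≤ δ := by positivity
  have hδk : ∀ x, k / 2 ≤ |x| → (C / k) ^ 2 ≤ δ * |x| ^ p := by
    intro x hx
    have h : (k / 2) ^ p ≤ |x| ^ p := Real.rpow_le_rpow (by positivity) hx hp0.le
    calc (C / k) ^ 2 = δ * (k / 2) ^ p := by
          rw [hδ, Real.div_rpow hk0.le (by norm_num), Real.rpow_neg hk0.le]
          have := (Real.rpow_pos_of_pos hk0 p).ne'
          have := (Real.rpow_pos_of_pos (two_pos (α := ℝ)) p).ne'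
          field_simp
      _ ≤ δ * |x| ^ p := mul_le_mul_of_nonneg_left h hδ0
  have hsmall : δ * γ ≤ ε * k ^ (-(p / 2)) := by
    have hk3 : C ^ 2 * 2 ^ p * γ ≤ ε * k := by
      rw [mul_comm ε, ← div_le_iff₀ hε]
      linarith
    have h1 : k ^ (-p) ≤ k ^ (-(p / 2)) :=
      Real.rpow_le_rpow_of_exponent_le (by linarith) (by linarith)
    have h2 : ε * k / k ^ 2 ≤ ε := by
      rw [div_le_iff₀ (by positivity)]
      nlinarith [mul_pos hε hk0]
    calc δ * γ = C ^ 2 * 2 ^ p * γ / k ^ 2 * k ^ (-p) := by rw [hδ]; ring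
      _ ≤ ε * k / k ^ 2 * k ^ (-p) := by gcongr
      _ ≤ ε * k ^ (-(p / 2)) := by gcongr
  have habs : ∀ x, |x / k| = |x| / k := fun x => by rw [abs_div, abs_of_pos hk0]
  have hloc := gammaP_le_one_add_mul_energy (p := p) (k := k) (R := 3 / 4 * k) (δ := δ)
    (θ := fun x => Θ (x / k)) hp0 hk0 (by linarith) hδ0
    ((hΘ.comp (contDiff_id.div_const k)).of_le (by simp))
    (fun x hx => by
      rw [hΘ1 _ (by rwa [habs, le_div_iff₀ hk0]), Real.cos_pi_div_two])
    (fun x => by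
      rcases le_total |x| (k / 2) with hx | hx
      · exact Or.inl (hΘ0 _ (by rw [habs, div_le_iff₀ hk0]; linarith))
      · refine Or.inr ?_
        have h1 : γ + 1 ≤ |x| := by linarith
        calc γ ≤ |x| ^ (1 : ℝ) := by rw [Real.rpow_one]; linarith
          _ ≤ |x| ^ p := Real.rpow_le_rpow_of_exponent_le (by linarith) hp)
    (fun x => by
      rcases lt_or_ge |x| (k / 2) with hx | hx
      · have : (fun x => Θ (x / k)) =ᶠ[𝓝 x] fun _ => 0 := by
          filter_upwards [(isOpen_lt continuous_abs continuous_const).mem_nhds hx] with y hy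
          have hy' : |y| < k / 2 := hy
          exact hΘ0 _ (by rw [habs, div_le_iff₀ hk0]; linarith)
        rw [this.deriv_eq, deriv_const, zero_pow two_ne_zero]
        positivity
      · refine le_trans ?_ (hδk x hx)
        have hd : deriv (fun x => Θ (x / k)) x = deriv Θ (x / k) / k := by
          have := ((hΘ.differentiable (by simp) (x / k)).hasDerivAt.comp x
            ((hasDerivAt_id x).div_const k)).deriv
          rw [mul_one_div] at this
          exact this
        rw [hd, div_pow, div_pow]
        exact div_le_div_of_nonneg_right
          (sq_le_sq' (neg_le_of_abs_le (hC _)) (le_of_abs_le (hC _))) (by positivity))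
    hψ hn
  rcases le_total γ (∫ x in Set.Icc (-k) k, (deriv ψ x ^ 2 + |x| ^ p * ψ x ^ 2)) with h | h
  · linarith [mul_nonneg hε.le (Real.rpow_nonneg hk0.le (-(p / 2)))]
  · nlinarith [mul_le_mul_of_nonneg_left h hδ0]
end

section
/- Let p ≥ 1, let g: ℝ → ℝ be measurable with ∫_ℝ t² g(t)² dt < ∞, let χ: ℝ → ℝ be measurable with χ(z) = 0 for z ∉ [1,2], and let k ≥ 1. Then ∫_0^∞ ∫_ℝ (x² / (k^{2/(p+2)} y^{2(p+4)/(p+2)})) g(x y^{p/(p+2)})² χ(y/k)² dx dy ≤ k^{−4} (∫_1^2 χ(z)² dz) (∫_ℝ t² g(t)² dt). -/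
open MeasureTheory

/-- Scaling of the second moment: `∫ x² g(xc)² dx = c⁻³ ∫ t² g(t)² dt` for `c > 0`. -/
theorem integral_sq_mul_sq_comp_mul_right (g : ℝ → ℝ) {c : ℝ} (hc : 0 < c) :
    ∫ x : ℝ, x ^ 2 * g (x * c) ^ 2 = (c ^ 3)⁻¹ * ∫ t : ℝ, t ^ 2 * g t ^ 2 := by
  have h := Measure.integral_comp_mul_right (fun t : ℝ => t ^ 2 * g t ^ 2) c
  rw [abs_of_pos (inv_pos.2 hc), smul_eq_mul] at h
  calc ∫ x : ℝ, x ^ 2 * g (x * c) ^ 2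
      = ∫ x : ℝ, (c ^ 2)⁻¹ * ((x * c) ^ 2 * g (x * c) ^ 2) := by
        congr 1; ext x; field_simp
    _ = (c ^ 3)⁻¹ * ∫ t : ℝ, t ^ 2 * g t ^ 2 := by
        rw [integral_const_mul, h]; field_simp

/-- The inner integral of the Weyl term, evaluated at height `y > 0`. -/
theorem integral_weyl_term_slice {p k y : ℝ} (hp : 0 < p + 2) (hy : 0 < y) (g : ℝ → ℝ) (s : ℝ) :
    (∫ x : ℝ, (x ^ 2 / (k ^ ((2 : ℝ) / (p + 2)) * y ^ (2 * (p + 4) / (p + 2)))) *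
        (g (x * y ^ (p / (p + 2)))) ^ 2 * s ^ 2) =
      (k ^ ((2 : ℝ) / (p + 2)))⁻¹ * y ^ (-((5 * p + 8) / (p + 2))) *
        (∫ t : ℝ, t ^ 2 * (g t) ^ 2) * s ^ 2 := by
  have hexp : y ^ (-((5 * p + 8) / (p + 2))) =
      (y ^ (2 * (p + 4) / (p + 2)))⁻¹ * ((y ^ (p / (p + 2))) ^ 3)⁻¹ := by
    rw [← Real.rpow_natCast, ← Real.rpow_mul hy.le, ← Real.rpow_neg hy.le, ← Real.rpow_neg hy.le,
      ← Real.rpow_add hy]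
    congr 1
    push_cast
    field_simp
    ring
  rw [hexp, integral_mul_const]
  simp_rw [div_mul_eq_mul_div, div_eq_mul_inv]
  rw [integral_mul_const]
  simp_rw [← div_eq_mul_inv]
  rw [integral_sq_mul_sq_comp_mul_right g (Real.rpow_pos_of_pos hy _)]
  rw [div_eq_mul_inv, mul_inv]
  ring

/-- Smallness of the first term coming from `∂²ψ_k/∂y²` for the Weyl sequence:
if `∫ t² g(t)² dt < ∞` and `χ` vanishes outside `[1,2]`, then for every `k ≥ 1`
`∫_0^∞ ∫_ℝ (x²/(k^{2/(p+2)} y^{2(p+4)/(p+2)})) g(x y^{p/(p+2)})² χ(y/k)² dx dy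
  ≤ k^{-4} (∫_1^2 χ²) (∫_ℝ t² g(t)²)`. -/
theorem weyl_derivative_term_bound (p : ℝ) (hp : 1 ≤ p)
    (g χ : ℝ → ℝ) (hg : Measurable g) (hχ : Measurable χ)
    (hgint : Integrable (fun t : ℝ => t ^ 2 * (g t) ^ 2))
    (hχ0 : ∀ z : ℝ, z ∉ Set.Icc (1 : ℝ) 2 → χ z = 0)
    (k : ℝ) (hk : 1 ≤ k) :
    (∫ y in Set.Ioi (0 : ℝ), ∫ x : ℝ,
        (x ^ 2 / (k ^ ((2 : ℝ) / (p + 2)) * y ^ (2 * (p + 4) / (p + 2)))) *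
          (g (x * y ^ (p / (p + 2)))) ^ 2 * (χ (y / k)) ^ 2) ≤
      k ^ (-(4 : ℝ)) * (∫ z in (1 : ℝ)..2, (χ z) ^ 2) *
        (∫ t : ℝ, t ^ 2 * (g t) ^ 2) := by
  have hp2 : 0 < p + 2 := by linarith
  have hk0 : 0 < k := by linarith
  set M := ∫ t : ℝ, t ^ 2 * (g t) ^ 2
  have hM : 0 ≤ M := integral_nonneg fun t => by positivity
  set A := (k ^ ((2 : ℝ) / (p + 2)))⁻¹ with hA
  have hApos : 0 < A := by positivity
  set b := (5 * p + 8) / (p + 2) with hb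
  have hbpos : 0 ≤ b := by positivity
  have hsupp : ∀ y : ℝ, y ∉ Set.Icc k (2 * k) → χ (y / k) = 0 := fun y hy =>
    hχ0 _ fun h => hy ⟨by simpa using (le_div_iff₀ hk0).1 h.1, (div_le_iff₀ hk0).1 h.2⟩
  have hleft : (∫ y in Set.Ioi (0 : ℝ), ∫ x : ℝ,
        (x ^ 2 / (k ^ ((2 : ℝ) / (p + 2)) * y ^ (2 * (p + 4) / (p + 2)))) *
          (g (x * y ^ (p / (p + 2)))) ^ 2 * (χ (y / k)) ^ 2) =
      ∫ y : ℝ, A * y ^ (-b) * M * χ (y / k) ^ 2 := by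
    rw [setIntegral_congr_fun measurableSet_Ioi fun y hy => integral_weyl_term_slice hp2 hy g _]
    refine setIntegral_eq_integral_of_forall_compl_eq_zero fun y hy => ?_
    rw [hsupp y fun h => hy (hk0.trans_le h.1)]
    simp
  have hright : ∫ z in (1 : ℝ)..2, (χ z) ^ 2 = ∫ z, χ z ^ 2 := by
    rw [intervalIntegral.integral_of_le one_le_two, ← integral_Icc_eq_integral_Ioc]
    exact setIntegral_eq_integral_of_forall_compl_eq_zero fun z hz => by simp [hχ0 z hz]
  have hscale : ∫ y, χ (y / k) ^ 2 = k * ∫ z, χ z ^ 2 := by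
    rw [Measure.integral_comp_div (fun z => χ z ^ 2) k, abs_of_pos hk0, smul_eq_mul]
  have hpow : A * k ^ (-b) * k = k ^ (-(4 : ℝ)) := by
    rw [hA, ← Real.rpow_neg hk0.le, ← Real.rpow_add hk0, ← Real.rpow_add_one hk0.ne', hb]
    congr 1
    field_simp
    ring
  have hrhs : k ^ (-(4 : ℝ)) * (∫ z, χ z ^ 2) * M =
      ∫ y, A * k ^ (-b) * M * χ (y / k) ^ 2 := by
    rw [integral_const_mul, hscale, ← hpow]
    ring
  rw [hleft, hright, hrhs]
  by_cases hint : Integrable fun y => χ (y / k) ^ 2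
  · refine integral_mono_of_nonneg (.of_forall fun y => ?_) (hint.const_mul _)
      (.of_forall fun y => ?_)
    · by_cases hy : y ∈ Set.Icc k (2 * k)
      · have : 0 < y := hk0.trans_le hy.1
        simp only [Pi.zero_apply]
        positivity
      · simp [hsupp y hy]
    · by_cases hy : y ∈ Set.Icc k (2 * k)
      · have := Real.rpow_le_rpow_of_nonpos hk0 hy.1 (neg_nonpos.2 hbpos)
        dsimp only
        gcongr
      · simp [hsupp y hy]
  · rw [integral_const_mul, integral_undef hint, mul_zero]
    rcases hM.eq_or_lt with hM0 | hMpos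
    · simp [← hM0]
    refine (integral_undef fun h => hint ?_).le
    have hw : 0 < A * (2 * k) ^ (-b) * M := by positivity
    refine (h.const_mul (A * (2 * k) ^ (-b) * M)⁻¹).mono'
      ((hχ.comp (measurable_id.div_const k)).pow_const 2).aestronglyMeasurable
      (.of_forall fun y => ?_)
    rw [Real.norm_of_nonneg (sq_nonneg _)]
    by_cases hy : y ∈ Set.Icc k (2 * k)
    · have := Real.rpow_le_rpow_of_nonpos (hk0.trans_le hy.1) hy.2 (neg_nonpos.2 hbpos)
      rw [le_inv_mul_iff₀ hw]
      gcongr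
    · simp [hsupp y hy]
end

section
/- Let p ≥ 1, let h: ℝ → ℝ be measurable with ∫_ℝ |t|^{4p/(p+2)} h(t)² dt < ∞, let χ: ℝ → ℝ be measurable with χ(z) = 0 for z ∉ [1,2], and let k ≥ 1. Then k^{−2/(p+2)} ∫_0^∞ ∫_ℝ ((x²+y²)^{p/(p+2)} − y^{2p/(p+2)})² h(x y^{p/(p+2)})² χ(y/k)² dx dy ≤ k^{−4p²/(p+2)²} (∫_1^2 χ(z)² dz) (∫_ℝ |t|^{4p/(p+2)} h(t)² dt); in particular this quantity tends to 0 as k → ∞. -/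
open MeasureTheory Filter

/-- The quantity showing that the negative potential part is asymptotically
compensated along the Weyl sequence:
`F(k) = k^{-2/(p+2)} ∫_0^∞ ∫_ℝ ((x²+y²)^{p/(p+2)} − y^{2p/(p+2)})² h(x y^{p/(p+2)})² χ(y/k)² dx dy`. -/
noncomputable def compensationTerm (p : ℝ) (h χ : ℝ → ℝ) (k : ℝ) : ℝ :=
  k ^ (-(2 : ℝ) / (p + 2)) *
    ∫ y in Set.Ioi (0 : ℝ), ∫ x : ℝ,
      ((x ^ 2 + y ^ 2) ^ (p / (p + 2)) - y ^ (2 * p / (p + 2))) ^ 2 *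
        (h (x * y ^ (p / (p + 2)))) ^ 2 * (χ (y / k)) ^ 2

/-- Increments of a concave power `s ↦ s ^ q` decrease along the half-line. -/
lemma add_rpow_sub_rpow_antitone {q a s t : ℝ} (hq0 : 0 ≤ q) (hq1 : q ≤ 1) (ha : 0 ≤ a)
    (hs : 0 ≤ s) (hst : s ≤ t) :
    (a + t) ^ q - t ^ q ≤ (a + s) ^ q - s ^ q := by
  rcases eq_or_lt_of_le hst with rfl | hlt
  · exact le_rfl
  have hL : 0 < t - s + a := by linarith
  have hconc := (Real.concaveOn_rpow hq0 hq1).2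
  have hsum : (t - s) / (t - s + a) + a / (t - s + a) = 1 := by field_simp
  have hu : 0 ≤ (t - s) / (t - s + a) := div_nonneg (by linarith) hL.le
  have hv : 0 ≤ a / (t - s + a) := div_nonneg ha hL.le
  have hsm : s ∈ Set.Ici (0 : ℝ) := hs
  have htm : a + t ∈ Set.Ici (0 : ℝ) := by
    simp only [Set.mem_Ici]
    linarith
  have h₁ := hconc hsm htm hu hv hsum
  have h₂ := hconc hsm htm hv hu (by rw [add_comm]; exact hsum)
  simp only [smul_eq_mul] at h₁ h₂
  have e₁ : (t - s) / (t - s + a) * s + a / (t - s + a) * (a + t) = a + s := by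
    field_simp
    ring
  have e₂ : a / (t - s + a) * s + (t - s) / (t - s + a) * (a + t) = t := by
    field_simp
    ring
  rw [e₁] at h₁
  rw [e₂] at h₂
  have hfin : ((t - s) / (t - s + a) + a / (t - s + a)) * (s ^ q + (a + t) ^ q)
      ≤ (a + s) ^ q + t ^ q := by linarith
  rw [hsum] at hfin
  linarith

/-- The potential difference `(x² + y²)^q - y^{2q}`. -/
noncomputable def potentialGap (q x y : ℝ) : ℝ :=
  (x ^ 2 + y ^ 2) ^ q - y ^ (2 * q)

lemma sq_rpow_eq_abs_rpow (q x : ℝ) : (x ^ 2) ^ q = |x| ^ (2 * q) := by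
  rw [← sq_abs, ← Real.rpow_natCast, ← Real.rpow_mul (abs_nonneg x)]
  norm_num

lemma potentialGap_eq {q y : ℝ} (x : ℝ) (hy : 0 ≤ y) :
    potentialGap q x y = (x ^ 2 + y ^ 2) ^ q - (y ^ 2) ^ q := by
  rw [potentialGap, sq_rpow_eq_abs_rpow, abs_of_nonneg hy]

lemma potentialGap_nonneg {q y : ℝ} (x : ℝ) (hq0 : 0 ≤ q) (hy : 0 ≤ y) :
    0 ≤ potentialGap q x y := by
  rw [potentialGap_eq x hy, sub_nonneg]
  exact Real.rpow_le_rpow (sq_nonneg y) (by nlinarith [sq_nonneg x]) hq0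

lemma potentialGap_pos {q x y : ℝ} (hq0 : 0 < q) (hx : x ≠ 0) (hy : 0 ≤ y) :
    0 < potentialGap q x y := by
  rw [potentialGap_eq x hy, sub_pos]
  exact Real.rpow_lt_rpow (sq_nonneg y) (by nlinarith [sq_pos_of_ne_zero hx]) hq0

lemma potentialGap_le {q y : ℝ} (x : ℝ) (hq0 : 0 ≤ q) (hq1 : q ≤ 1) (hy : 0 ≤ y) :
    potentialGap q x y ≤ |x| ^ (2 * q) := by
  rw [potentialGap_eq x hy, ← sq_rpow_eq_abs_rpow]
  linarith [Real.rpow_add_le_add_rpow (sq_nonneg x) (sq_nonneg y) hq0 hq1]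

lemma potentialGap_sq_le {q y : ℝ} (x : ℝ) (hq0 : 0 ≤ q) (hq1 : q ≤ 1) (hy : 0 ≤ y) :
    potentialGap q x y ^ 2 ≤ |x| ^ (4 * q) := by
  have h := pow_le_pow_left₀ (potentialGap_nonneg x hq0 hy) (potentialGap_le x hq0 hq1 hy) 2
  rwa [← Real.rpow_natCast (|x| ^ (2 * q)), ← Real.rpow_mul (abs_nonneg x),
    show 2 * q * ((2 : ℕ) : ℝ) = 4 * q by push_cast; ring] at h

lemma potentialGap_mono_antitone {q x₁ x₂ y₁ y₂ : ℝ} (hq0 : 0 ≤ q) (hq1 : q ≤ 1)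
    (hy₁ : 0 ≤ y₁) (hy : y₁ ≤ y₂) (hx : |x₂| ≤ |x₁|) :
    potentialGap q x₂ y₂ ≤ potentialGap q x₁ y₁ := by
  rw [potentialGap_eq _ hy₁, potentialGap_eq _ (hy₁.trans hy)]
  have h₁ := add_rpow_sub_rpow_antitone hq0 hq1 (sq_nonneg x₂) (sq_nonneg y₁)
    (pow_le_pow_left₀ hy₁ hy 2)
  have h₂ : (x₂ ^ 2 + y₁ ^ 2) ^ q ≤ (x₁ ^ 2 + y₁ ^ 2) ^ q :=
    Real.rpow_le_rpow (by positivity) (by linarith [sq_le_sq.2 hx]) hq0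
  linarith

/-- The inner integral of the compensation term, without the cutoff. -/
noncomputable def innerIntegral (q : ℝ) (h : ℝ → ℝ) (y : ℝ) : ℝ :=
  ∫ x : ℝ, potentialGap q x y ^ 2 * h (x * y ^ q) ^ 2

lemma innerIntegral_nonneg (q : ℝ) (h : ℝ → ℝ) (y : ℝ) : 0 ≤ innerIntegral q h y :=
  integral_nonneg fun _ => by positivity

section

variable {q : ℝ} {h : ℝ → ℝ}

lemma abs_rpow_mul_comp_eq {y : ℝ} (x : ℝ) (hy : 0 < y) :
    |x| ^ (4 * q) * h (x * y ^ q) ^ 2 =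
      y ^ (-(4 * q ^ 2)) * (|x * y ^ q| ^ (4 * q) * h (x * y ^ q) ^ 2) := by
  have hyq : 0 < y ^ q := Real.rpow_pos_of_pos hy q
  rw [abs_mul, abs_of_pos hyq, Real.mul_rpow (abs_nonneg x) hyq.le, ← Real.rpow_mul hy.le]
  have e : y ^ (-(4 * q ^ 2)) * y ^ (q * (4 * q)) = 1 := by
    rw [← Real.rpow_add hy, show -(4 * q ^ 2) + q * (4 * q) = 0 by ring, Real.rpow_zero]
  linear_combination (-(|x| ^ (4 * q) * h (x * y ^ q) ^ 2)) * e

lemma integrable_abs_rpow_mul_comp {y : ℝ} (hy : 0 < y)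
    (hint : Integrable fun t : ℝ => |t| ^ (4 * q) * h t ^ 2) :
    Integrable fun x : ℝ => |x| ^ (4 * q) * h (x * y ^ q) ^ 2 := by
  simp_rw [abs_rpow_mul_comp_eq _ hy]
  exact (hint.comp_mul_right' (Real.rpow_pos_of_pos hy q).ne').const_mul _

lemma integral_abs_rpow_mul_comp {y : ℝ} (hy : 0 < y) :
    ∫ x : ℝ, |x| ^ (4 * q) * h (x * y ^ q) ^ 2 =
      y ^ (-(4 * q ^ 2) - q) * ∫ t : ℝ, |t| ^ (4 * q) * h t ^ 2 := by
  have hyq : 0 < y ^ q := Real.rpow_pos_of_pos hy q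
  simp_rw [abs_rpow_mul_comp_eq _ hy]
  rw [integral_const_mul,
    Measure.integral_comp_mul_right (fun t : ℝ => |t| ^ (4 * q) * h t ^ 2) (y ^ q),
    abs_of_pos (inv_pos.2 hyq), ← Real.rpow_neg hy.le, smul_eq_mul, ← mul_assoc,
    ← Real.rpow_add hy, sub_eq_add_neg]

lemma innerIntegral_le {y : ℝ} (hq0 : 0 ≤ q) (hq1 : q ≤ 1) (hy : 0 < y)
    (hint : Integrable fun t : ℝ => |t| ^ (4 * q) * h t ^ 2) :
    innerIntegral q h y ≤ y ^ (-(4 * q ^ 2) - q) * ∫ t : ℝ, |t| ^ (4 * q) * h t ^ 2 := by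
  rw [← integral_abs_rpow_mul_comp hy]
  exact integral_mono_of_nonneg (.of_forall fun x => by positivity)
    (integrable_abs_rpow_mul_comp hy hint) (.of_forall fun x =>
      mul_le_mul_of_nonneg_right (potentialGap_sq_le x hq0 hq1 hy.le) (sq_nonneg _))

lemma measurable_potentialGap (y : ℝ) : Measurable fun x => potentialGap q x y := by
  unfold potentialGap
  fun_prop

lemma integrable_inner {y : ℝ} (hq0 : 0 ≤ q) (hq1 : q ≤ 1) (hy : 0 < y) (hh : Measurable h)
    (hint : Integrable fun t : ℝ => |t| ^ (4 * q) * h t ^ 2) :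
    Integrable fun x : ℝ => potentialGap q x y ^ 2 * h (x * y ^ q) ^ 2 := by
  refine (integrable_abs_rpow_mul_comp hy hint).mono' ?_ (.of_forall fun x => ?_)
  · have := measurable_potentialGap (q := q) y
    exact Measurable.aestronglyMeasurable (by fun_prop)
  · rw [Real.norm_of_nonneg (by positivity)]
    exact mul_le_mul_of_nonneg_right (potentialGap_sq_le x hq0 hq1 hy.le) (sq_nonneg _)

lemma inner_comp_eq {y : ℝ} (hy : 0 < y) (x : ℝ) :
    potentialGap q x y ^ 2 * h (x * y ^ q) ^ 2 =
      (fun t => potentialGap q (t * y ^ (-q)) y ^ 2 * h t ^ 2) (x * y ^ q) := by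
  have e : x * y ^ q * y ^ (-q) = x := by
    rw [mul_assoc, ← Real.rpow_add hy, add_neg_cancel, Real.rpow_zero, mul_one]
  simp only [e]

lemma innerIntegral_eq {y : ℝ} (hy : 0 < y) :
    innerIntegral q h y =
      y ^ (-q) * ∫ t : ℝ, potentialGap q (t * y ^ (-q)) y ^ 2 * h t ^ 2 := by
  have hyq : 0 < y ^ q := Real.rpow_pos_of_pos hy q
  unfold innerIntegral
  simp_rw [inner_comp_eq hy]
  rw [Measure.integral_comp_mul_right
    (fun t => potentialGap q (t * y ^ (-q)) y ^ 2 * h t ^ 2) (y ^ q),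
    abs_of_pos (inv_pos.2 hyq), ← Real.rpow_neg hy.le, smul_eq_mul]

lemma integrable_inner_rescaled {y : ℝ} (hq0 : 0 ≤ q) (hq1 : q ≤ 1) (hy : 0 < y)
    (hh : Measurable h) (hint : Integrable fun t : ℝ => |t| ^ (4 * q) * h t ^ 2) :
    Integrable fun t : ℝ => potentialGap q (t * y ^ (-q)) y ^ 2 * h t ^ 2 := by
  have hyq : 0 < y ^ q := Real.rpow_pos_of_pos hy q
  have hi := integrable_inner hq0 hq1 hy hh hint
  simp_rw [inner_comp_eq hy] at hi
  exact (integrable_comp_mul_right_iff _ hyq.ne').1 hi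

lemma innerIntegral_antitone {y₁ y₂ : ℝ} (hq0 : 0 ≤ q) (hq1 : q ≤ 1) (hy₁ : 0 < y₁)
    (hy : y₁ ≤ y₂) (hh : Measurable h)
    (hint : Integrable fun t : ℝ => |t| ^ (4 * q) * h t ^ 2) :
    innerIntegral q h y₂ ≤ innerIntegral q h y₁ := by
  have hy₂ := hy₁.trans_le hy
  have hpow : y₂ ^ (-q) ≤ y₁ ^ (-q) :=
    Real.rpow_le_rpow_of_nonpos hy₁ hy (neg_nonpos.2 hq0)
  have h₂ : 0 ≤ y₂ ^ (-q) := Real.rpow_nonneg hy₂.le _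
  rw [innerIntegral_eq hy₁, innerIntegral_eq hy₂]
  refine mul_le_mul hpow (integral_mono (integrable_inner_rescaled hq0 hq1 hy₂ hh hint)
    (integrable_inner_rescaled hq0 hq1 hy₁ hh hint) fun t => ?_)
    (integral_nonneg fun t => by positivity) (Real.rpow_nonneg hy₁.le _)
  refine mul_le_mul_of_nonneg_right (pow_le_pow_left₀ (potentialGap_nonneg _ hq0 hy₂.le) ?_ 2)
    (sq_nonneg _)
  refine potentialGap_mono_antitone hq0 hq1 hy₁.le hy ?_
  rw [abs_mul, abs_mul, abs_of_nonneg h₂, abs_of_nonneg (h₂.trans hpow)]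
  exact mul_le_mul_of_nonneg_left hpow (abs_nonneg t)

lemma integral_eq_zero_of_innerIntegral_eq_zero {y : ℝ} (hq0 : 0 < q) (hq1 : q ≤ 1)
    (hy : 0 < y) (hh : Measurable h)
    (hint : Integrable fun t : ℝ => |t| ^ (4 * q) * h t ^ 2)
    (hzero : innerIntegral q h y = 0) :
    ∫ t : ℝ, |t| ^ (4 * q) * h t ^ 2 = 0 := by
  have hyq : 0 < y ^ (-q) := Real.rpow_pos_of_pos hy _
  rw [innerIntegral_eq hy, mul_eq_zero, or_iff_right hyq.ne',
    integral_eq_zero_iff_of_nonneg (fun t => by positivity)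
      (integrable_inner_rescaled hq0.le hq1 hy hh hint)] at hzero
  refine integral_eq_zero_of_ae ?_
  filter_upwards [hzero] with t ht
  rcases eq_or_ne t 0 with rfl | hne
  · simp [Real.zero_rpow (by positivity : (4 * q) ≠ 0)]
  · have hg := potentialGap_pos hq0 (mul_ne_zero hne hyq.ne') hy.le
    have hz : h t ^ 2 = 0 := (mul_eq_zero.1 ht).resolve_left (by positivity)
    simp [hz]

end

lemma compensationTerm_eq (p : ℝ) (h χ : ℝ → ℝ) (k : ℝ) :
    compensationTerm p h χ k = k ^ (-(2 : ℝ) / (p + 2)) *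
      ∫ y in Set.Ioi (0 : ℝ), innerIntegral (p / (p + 2)) h y * χ (y / k) ^ 2 := by
  simp_rw [compensationTerm, innerIntegral, potentialGap, ← integral_mul_const,
    mul_div_assoc]

lemma compensationTerm_nonneg (p : ℝ) (h χ : ℝ → ℝ) {k : ℝ} (hk : 0 ≤ k) :
    0 ≤ compensationTerm p h χ k := by
  rw [compensationTerm_eq]
  exact mul_nonneg (Real.rpow_nonneg hk _)
    (integral_nonneg fun y => mul_nonneg (innerIntegral_nonneg _ _ _) (sq_nonneg _))

section

variable {q k : ℝ} {h χ : ℝ → ℝ}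

lemma innerIntegral_mul_cutoff_le (hq0 : 0 ≤ q) (hq1 : q ≤ 1) (hk : 0 < k)
    (hint : Integrable fun t : ℝ => |t| ^ (4 * q) * h t ^ 2)
    (hχ0 : ∀ z : ℝ, z ∉ Set.Icc (1 : ℝ) 2 → χ z = 0) (y : ℝ) :
    innerIntegral q h y * χ (y / k) ^ 2 ≤
      k ^ (-(4 * q ^ 2) - q) * (∫ t : ℝ, |t| ^ (4 * q) * h t ^ 2) * χ (y / k) ^ 2 := by
  by_cases hz : y / k ∈ Set.Icc (1 : ℝ) 2
  · have hky : k ≤ y := (one_le_div hk).1 hz.1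
    refine mul_le_mul_of_nonneg_right ?_ (sq_nonneg _)
    refine (innerIntegral_le hq0 hq1 (hk.trans_le hky) hint).trans
      (mul_le_mul_of_nonneg_right ?_ (integral_nonneg fun t => by positivity))
    exact Real.rpow_le_rpow_of_nonpos hk hky (by nlinarith [sq_nonneg q])
  · simp [hχ0 _ hz]

/-- If the weighted cutoff is integrable, then so is the cutoff, except in the degenerate
case of a vanishing profile. -/
lemma integrable_cutoff_of_integrable (hq0 : 0 < q) (hq1 : q ≤ 1) (hk : 0 < k)
    (hh : Measurable h) (hχ : Measurable χ)
    (hint : Integrable fun t : ℝ => |t| ^ (4 * q) * h t ^ 2)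
    (hχ0 : ∀ z : ℝ, z ∉ Set.Icc (1 : ℝ) 2 → χ z = 0)
    (hne : ∫ t : ℝ, |t| ^ (4 * q) * h t ^ 2 ≠ 0)
    (hG : IntegrableOn (fun y => innerIntegral q h y * χ (y / k) ^ 2) (Set.Ioi 0)) :
    Integrable fun z => χ z ^ 2 := by
  have hI : innerIntegral q h (2 * k) ≠ 0 := fun h0 =>
    hne (integral_eq_zero_of_innerIntegral_eq_zero hq0 hq1 (by positivity) hh hint h0)
  have hsupp : Function.support (fun y => innerIntegral q h y * χ (y / k) ^ 2) ⊆
      Set.Ioi 0 := by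
    intro y hy
    by_contra hy0
    refine hy ?_
    have : y / k ∉ Set.Icc (1 : ℝ) 2 := fun hz =>
      hy0 (hk.trans_le ((one_le_div hk).1 hz.1))
    simp [hχ0 _ this]
  rw [integrableOn_iff_integrable_of_support_subset hsupp] at hG
  have hc : Integrable fun y => innerIntegral q h (2 * k) * χ (y / k) ^ 2 := by
    refine hG.mono' (Measurable.aestronglyMeasurable (by fun_prop)) (.of_forall fun y => ?_)
    rw [Real.norm_of_nonneg (mul_nonneg (innerIntegral_nonneg _ _ _) (sq_nonneg _))]
    by_cases hz : y / k ∈ Set.Icc (1 : ℝ) 2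
    · exact mul_le_mul_of_nonneg_right (innerIntegral_antitone hq0.le hq1
        (hk.trans_le ((one_le_div hk).1 hz.1)) ((div_le_iff₀ hk).1 hz.2) hh hint) (sq_nonneg _)
    · simp [hχ0 _ hz]
  rw [integrable_const_mul_iff (isUnit_iff_ne_zero.2 hI)] at hc
  simp_rw [div_eq_mul_inv] at hc
  exact (integrable_comp_mul_right_iff (fun z => χ z ^ 2) (inv_ne_zero hk.ne')).1 hc

lemma integral_cutoff_scaled (hk : 0 < k)
    (hχ0 : ∀ z : ℝ, z ∉ Set.Icc (1 : ℝ) 2 → χ z = 0) :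
    ∫ y in Set.Ioi (0 : ℝ), χ (y / k) ^ 2 = k * ∫ z in (1 : ℝ)..2, χ z ^ 2 := by
  rw [setIntegral_eq_integral_of_forall_compl_eq_zero,
    Measure.integral_comp_div (fun z => χ z ^ 2) k, abs_of_pos hk, smul_eq_mul,
    intervalIntegral.integral_of_le one_le_two, ← integral_Icc_eq_integral_Ioc,
    setIntegral_eq_integral_of_forall_compl_eq_zero]
  · intro z hz
    simp [hχ0 z hz]
  · intro y hy
    have : y / k ∉ Set.Icc (1 : ℝ) 2 := fun hz =>
      hy (hk.trans_le ((one_le_div hk).1 hz.1))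
    simp [hχ0 _ this]

lemma integral_innerIntegral_mul_cutoff_le (hq0 : 0 < q) (hq1 : q ≤ 1) (hk : 0 < k)
    (hh : Measurable h) (hχ : Measurable χ)
    (hint : Integrable fun t : ℝ => |t| ^ (4 * q) * h t ^ 2)
    (hχ0 : ∀ z : ℝ, z ∉ Set.Icc (1 : ℝ) 2 → χ z = 0) :
    ∫ y in Set.Ioi (0 : ℝ), innerIntegral q h y * χ (y / k) ^ 2 ≤
      k ^ (-(4 * q ^ 2) - q) * (∫ t : ℝ, |t| ^ (4 * q) * h t ^ 2) *
        (k * ∫ z in (1 : ℝ)..2, χ z ^ 2) := by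
  have hle := innerIntegral_mul_cutoff_le hq0.le hq1 hk hint hχ0
  have hJ : 0 ≤ ∫ t : ℝ, |t| ^ (4 * q) * h t ^ 2 := integral_nonneg fun t => by positivity
  have hX : 0 ≤ ∫ z in (1 : ℝ)..2, χ z ^ 2 :=
    intervalIntegral.integral_nonneg one_le_two fun z _ => sq_nonneg _
  by_cases hG : IntegrableOn (fun y => innerIntegral q h y * χ (y / k) ^ 2) (Set.Ioi 0)
  · rcases eq_or_ne (∫ t : ℝ, |t| ^ (4 * q) * h t ^ 2) 0 with h0 | hne
    · simp only [h0, mul_zero, zero_mul] at hle ⊢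
      exact integral_nonpos hle
    · have hi := integrable_cutoff_of_integrable hq0 hq1 hk hh hχ hint hχ0 hne hG
      rw [← integral_cutoff_scaled hk hχ0, ← integral_const_mul]
      exact integral_mono hG ((hi.comp_div hk.ne').integrableOn.const_mul _) hle
  · rw [integral_undef hG]
    positivity

end

/-- If `∫ |t|^{4p/(p+2)} h(t)² dt < ∞` and `χ` vanishes outside `[1,2]`, then for
`k ≥ 1` the compensation term is bounded by
`k^{-4p²/(p+2)²} (∫_1^2 χ²) (∫ |t|^{4p/(p+2)} h²)`; in particular it tends to `0`
as `k → ∞`. -/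
theorem compensationTerm_bound (p : ℝ) (hp : 1 ≤ p)
    (h χ : ℝ → ℝ) (hh : Measurable h) (hχ : Measurable χ)
    (hhint : Integrable (fun t : ℝ => |t| ^ (4 * p / (p + 2)) * (h t) ^ 2))
    (hχ0 : ∀ z : ℝ, z ∉ Set.Icc (1 : ℝ) 2 → χ z = 0) :
    (∀ k : ℝ, 1 ≤ k →
      compensationTerm p h χ k ≤
        k ^ (-(4 * p ^ 2 / (p + 2) ^ 2)) * (∫ z in (1 : ℝ)..2, (χ z) ^ 2) *
          (∫ t : ℝ, |t| ^ (4 * p / (p + 2)) * (h t) ^ 2)) ∧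
    Tendsto (fun k : ℕ => compensationTerm p h χ (k : ℝ)) atTop (nhds 0) := by
  have hp2 : 0 < p + 2 := by linarith
  have hq0 : 0 < p / (p + 2) := by positivity
  have hq1 : p / (p + 2) ≤ 1 := (div_le_one hp2).2 (by linarith)
  have hbound : ∀ k : ℝ, 1 ≤ k →
      compensationTerm p h χ k ≤
        k ^ (-(4 * p ^ 2 / (p + 2) ^ 2)) * (∫ z in (1 : ℝ)..2, (χ z) ^ 2) *
          (∫ t : ℝ, |t| ^ (4 * p / (p + 2)) * (h t) ^ 2) := by
    intro k hk
    have hk0 : 0 < k := by linarith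
    simp_rw [mul_div_assoc] at hhint
    have hle := mul_le_mul_of_nonneg_left
      (integral_innerIntegral_mul_cutoff_le hq0 hq1 hk0 hh hχ hhint hχ0)
      (Real.rpow_nonneg hk0.le (-(2 : ℝ) / (p + 2)))
    rw [← compensationTerm_eq] at hle
    have hexp : k ^ (-(4 * p ^ 2 / (p + 2) ^ 2)) =
        k ^ (-(2 : ℝ) / (p + 2)) * k ^ (-(4 * (p / (p + 2)) ^ 2) - p / (p + 2)) * k := by
      rw [← Real.rpow_add hk0, ← Real.rpow_add_one hk0.ne']
      congr 1
      field_simp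
      ring
    refine hle.trans_eq ?_
    simp_rw [hexp, mul_div_assoc]
    ring
  refine ⟨hbound, ?_⟩
  have hlim : Tendsto (fun k : ℕ => (k : ℝ) ^ (-(4 * p ^ 2 / (p + 2) ^ 2)) *
      (∫ z in (1 : ℝ)..2, (χ z) ^ 2) *
        (∫ t : ℝ, |t| ^ (4 * p / (p + 2)) * (h t) ^ 2)) atTop (nhds 0) := by
    have := (tendsto_rpow_neg_atTop (by positivity : 0 < 4 * p ^ 2 / (p + 2) ^ 2)).comp
      tendsto_natCast_atTop_atTop
    simpa using (this.mul_const (∫ z in (1 : ℝ)..2, (χ z) ^ 2)).mul_const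
      (∫ t : ℝ, |t| ^ (4 * p / (p + 2)) * (h t) ^ 2)
  refine squeeze_zero' (.of_forall fun k => compensationTerm_nonneg p h χ k.cast_nonneg) ?_ hlim
  filter_upwards [eventually_ge_atTop 1] with k hk
  exact hbound k (by exact_mod_cast hk)
end

section
/- Let p ≥ 1, λ > 0, κ > 0, let α ≥ (λ/κ)^{(p+2)²/(4p(p+1))}, and let b ≥ 0, x ∈ ℝ. Then λ α^{−2p/(p+2)} ((x² α^{−2p/(p+2)} + b²)^{p/(p+2)} − b^{2p/(p+2)}) ≤ κ (|x|^p + 1). -/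
theorem Real.rpow_le_rpow_add_one {t r s : ℝ} (ht : 0 ≤ t) (hr : 0 ≤ r) (hrs : r ≤ s) :
    t ^ r ≤ t ^ s + 1 := by
  rcases le_total t 1 with h | h
  · linarith [Real.rpow_le_one ht h hr, Real.rpow_nonneg ht s]
  · linarith [Real.rpow_le_rpow_of_exponent_le h hrs]

theorem Real.mul_rpow_neg_le_of_div_rpow_inv_le {c d a e : ℝ} (hc : 0 < c) (hd : 0 < d)
    (he : 0 < e) (ha : (c / d) ^ e⁻¹ ≤ a) : c * a ^ (-e) ≤ d := by
  have hr : 0 < c / d := div_pos hc hd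
  have ha0 : 0 < a := (Real.rpow_pos_of_pos hr _).trans_le ha
  have h : c / d ≤ a ^ e := by
    simpa [Real.rpow_inv_rpow hr.le he.ne'] using
      Real.rpow_le_rpow (Real.rpow_nonneg hr.le _) ha he.le
  rw [Real.rpow_neg ha0.le, ← div_eq_mul_inv, div_le_iff₀ (Real.rpow_pos_of_pos ha0 _)]
  rwa [div_le_iff₀' hd] at h

/-- Inequality used in the proof of the Lieb–Thirring-type bound: for `p ≥ 1`,
`λ > 0`, `κ > 0`, `α ≥ (λ/κ)^{(p+2)²/(4p(p+1))}`, `b ≥ 0` and `x ∈ ℝ`,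
`λ α^{-2p/(p+2)} ((x² α^{-2p/(p+2)} + b²)^{p/(p+2)} − b^{2p/(p+2)}) ≤ κ(|x|^p + 1)`. -/
theorem bracketing_potential_bound_kappa (p lam κ α b x : ℝ) (hp : 1 ≤ p)
    (hlam : 0 < lam) (hκ : 0 < κ)
    (hα : (lam / κ) ^ ((p + 2) ^ 2 / (4 * p * (p + 1))) ≤ α) (hb : 0 ≤ b) :
    lam * α ^ (-(2 * p / (p + 2))) *
        ((x ^ 2 * α ^ (-(2 * p / (p + 2))) + b ^ 2) ^ (p / (p + 2)) -
          b ^ (2 * p / (p + 2))) ≤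
      κ * (|x| ^ p + 1) := by
  have hp0 : 0 < p := by linarith
  have hα0 : 0 < α := (Real.rpow_pos_of_pos (div_pos hlam hκ) _).trans_le hα
  set q := p / (p + 2) with hq
  have hq0 : 0 < q := by positivity
  have hq1 : q ≤ 1 := by rw [hq, div_le_one (by linarith)]; linarith
  have hqp : 2 * q ≤ p := by
    rw [hq, ← mul_div_assoc, div_le_iff₀ (by linarith)]; nlinarith
  have h2q : 2 * p / (p + 2) = 2 * q := mul_div_assoc _ _ _
  have he : (p + 2) ^ 2 / (4 * p * (p + 1)) = (2 * q * (1 + q))⁻¹ := by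
    rw [hq]; field_simp; ring
  rw [h2q]
  rw [he] at hα
  have hcoef := Real.mul_rpow_neg_le_of_div_rpow_inv_le hlam hκ (by positivity) hα
  have sq_rpow {t : ℝ} (ht : 0 ≤ t) : (t ^ 2) ^ q = t ^ (2 * q) := by
    rw [Real.rpow_mul ht, Real.rpow_two]
  have hdiff : (x ^ 2 * α ^ (-(2 * q)) + b ^ 2) ^ q - b ^ (2 * q) ≤
      |x| ^ (2 * q) * α ^ (-(2 * q) * q) := by
    have hsub := Real.rpow_add_le_add_rpow
      (show 0 ≤ x ^ 2 * α ^ (-(2 * q)) by positivity) (sq_nonneg b) hq0.le hq1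
    rw [Real.mul_rpow (sq_nonneg x) (by positivity), ← sq_abs x, sq_rpow (abs_nonneg x),
      sq_rpow hb, ← Real.rpow_mul hα0.le] at hsub
    rw [← sq_abs x]
    linarith
  calc lam * α ^ (-(2 * q)) * ((x ^ 2 * α ^ (-(2 * q)) + b ^ 2) ^ q - b ^ (2 * q))
      ≤ lam * α ^ (-(2 * q)) * (|x| ^ (2 * q) * α ^ (-(2 * q) * q)) := by gcongr
    _ = lam * α ^ (-(2 * q * (1 + q))) * |x| ^ (2 * q) := by
        rw [show -(2 * q * (1 + q)) = -(2 * q) + -(2 * q) * q by ring, Real.rpow_add hα0]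
        ring
    _ ≤ κ * (|x| ^ p + 1) := by
        gcongr
        exact Real.rpow_le_rpow_add_one (abs_nonneg x) (by positivity) hqp
end
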